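/- arXiv:1207.0572 — 3 statements merged into one kernel-verified Lean document; each statement's English description precedes it below -/
import Mathlib

section
/- In any linear (straight-edge) embedding of K_{3,3,1} in R^3 with vertices in general position, at most one 2-component link (triangle plus complementary quadrilateral) has linking number 2. -/
open scoped Classical

noncomputable section

/-- Points of `ℝ³`. -/
abbrev E3 := EuclideanSpace ℝ (Fin 3)

/-- The determinant of the three vectors `a, b, c` of `ℝ³`. -/
def det3 (a b c : E3) : ℝ :=
  a 0 * (b 1 * c 2 - b 2 * c 1) - a 1 * (b 0 * c 2 - b 2 * c 0) +
    a 2 * (b 0 * c 1 - b 1 * c 0)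

/-- The open flat triangular disk with vertices `A`, `B`, `C`. -/
def OpenTri (A B C : E3) : Set E3 :=
  {x | ∃ a b c : ℝ, 0 < a ∧ 0 < b ∧ 0 < c ∧ a + b + c = 1 ∧
    x = a • A + b • B + c • C}

/-- The segment `XY` pierces the open triangular disk `ABC`. -/
def Pierces (A B C X Y : E3) : Prop :=
  (openSegment ℝ X Y ∩ OpenTri A B C).Nonempty

/-- The signed intersection of the segment `XY` with the triangle `ABC`:
`±1` if `XY` pierces the open disk of `ABC` (the sign recording on which side of
the plane of `ABC` the point `X` lies), and `0` otherwise. -/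
def edgeSign (A B C X Y : E3) : ℤ :=
  if Pierces A B C X Y then
    (if 0 < det3 (B - A) (C - A) (X - A) then 1 else -1) else 0

/-- The linking number of the straight-edge triangle `ABC` with the straight-edge
quadrilateral `DEFG`: the signed count of intersections of the edges of the
quadrilateral with the flat disk bounded by the triangle. -/
def lkTriQuad (A B C D E F G : E3) : ℤ :=
  edgeSign A B C D E + edgeSign A B C E F + edgeSign A B C F G + edgeSign A B C G D

/-- Seven points in general position: no four of them are coplanar. -/
def GenPos7 (v : Fin 7 → E3) : Prop :=
  ∀ i j k l : Fin 7, i ≠ j → i ≠ k → i ≠ l → j ≠ k → j ≠ l → k ≠ l →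
    AffineIndependent ℝ ![v i, v j, v k, v l]

/-- The closed polygonal triangle (1-complex) with vertices `A`, `B`, `C`. -/
def cycle3 (A B C : E3) : Set E3 :=
  segment ℝ A B ∪ segment ℝ B C ∪ segment ℝ C A

/-- The closed polygonal quadrilateral with vertices `D`, `E`, `F`, `G`. -/
def cycle4 (D E F G : E3) : Set E3 :=
  segment ℝ D E ∪ segment ℝ E F ∪ segment ℝ F G ∪ segment ℝ G D

/-- A two-component link `(K, L)` in `ℝ³` is split (trivial): there is an ambient
isotopy of `ℝ³` (a continuous family of homeomorphisms starting at the identity,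
with continuously varying inverses) moving `K` and `L` to opposite sides of a
plane. -/
def SplitLink (K L : Set E3) : Prop :=
  ∃ H : ℝ → (E3 ≃ₜ E3),
    Continuous (fun q : ℝ × E3 => H q.1 q.2) ∧
    Continuous (fun q : ℝ × E3 => (H q.1).symm q.2) ∧
    (∀ x, H 0 x = x) ∧
    (∀ x ∈ K, H 1 x 0 < 0) ∧ (∀ x ∈ L, 0 < H 1 x 0)

/-- Vertices of `K₃,₃,₁` are `0,…,6`: part `{0,2,4}` (labels `1,3,5`), part
`{1,3,5}` (labels `2,4,6`), and the extra vertex `6` (label `7`). -/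
def odds : Fin 3 → Fin 7 := ![0, 2, 4]

/-- The second part of `K₃,₃`. -/
def evens : Fin 3 → Fin 7 := ![1, 3, 5]

/-- The triangle of the link indexed by `(a, b)`: vertex `7` together with the
`a`-th vertex of the first part and the `b`-th vertex of the second part. -/
def triOf (v : Fin 7 → E3) (a b : Fin 3) : Set E3 :=
  cycle3 (v 6) (v (odds a)) (v (evens b))

/-- The quadrilateral complementary to the triangle indexed by `(a, b)`: the
4-cycle on the remaining four vertices of `K₃,₃`. -/
def quadOf (v : Fin 7 → E3) (a b : Fin 3) : Set E3 :=
  cycle4 (v (odds (a + 1))) (v (evens (b + 1))) (v (odds (a + 2))) (v (evens (b + 2)))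

/-- The linking number (as a signed integer) of the triangle indexed by `(a, b)`
with its complementary quadrilateral. -/
def lk331 (v : Fin 7 → E3) (a b : Fin 3) : ℤ :=
  lkTriQuad (v 6) (v (odds a)) (v (evens b))
    (v (odds (a + 1))) (v (evens (b + 1))) (v (odds (a + 2))) (v (evens (b + 2)))

/-- The number of nontrivial (nonsplit) 2-component links among the nine
triangle/quadrilateral pairs of a linear embedding of `K₃,₃,₁`. -/
def linkCount (v : Fin 7 → E3) : ℕ :=
  (Finset.univ.filter fun p : Fin 3 × Fin 3 =>
    ¬ SplitLink (triOf v p.1 p.2) (quadOf v p.1 p.2)).card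

/-- Axioms for the (Boolean) chirotope of seven points in general position. -/
structure Chi (S : Fin 7 → Fin 7 → Fin 7 → Fin 7 → Bool) : Prop where
  s1' : ∀ i j k l, [i, j, k, l].Nodup → S i j k l = !S j i k l
  s2' : ∀ i j k l, [i, j, k, l].Nodup → S i j k l = !S i k j l
  s3' : ∀ i j k l, [i, j, k, l].Nodup → S i j k l = !S i j l k
  gp : ∀ a b c d e f, [a, b, c, d, e, f].Nodup →
    ((S a b c d == S a b e f) = (S a b c f == S a b d e) →
      (S a b c e == S a b d f) = (S a b c d == S a b e f))

theorem Chi.s1 {S : Fin 7 → Fin 7 → Fin 7 → Fin 7 → Bool} (h : Chi S) (i j k l : Fin 7)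
    (hn : j < i ∧ [i, j, k, l].Nodup) : S i j k l = !S j i k l := h.s1' i j k l hn.2

theorem Chi.s2 {S : Fin 7 → Fin 7 → Fin 7 → Fin 7 → Bool} (h : Chi S) (i j k l : Fin 7)
    (hn : k < j ∧ [i, j, k, l].Nodup) : S i j k l = !S i k j l := h.s2' i j k l hn.2

theorem Chi.s3 {S : Fin 7 → Fin 7 → Fin 7 → Fin 7 → Bool} (h : Chi S) (i j k l : Fin 7)
    (hn : l < k ∧ [i, j, k, l].Nodup) : S i j k l = !S i j l k := h.s3' i j k l hn.2

/-- The edge `df` crosses the triangle `abc`. -/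
def Cr (S : Fin 7 → Fin 7 → Fin 7 → Fin 7 → Bool) (a b c d f : Fin 7) : Prop :=
  S a b c d = !S a b c f ∧ S a b d f = S a b c f ∧ S b c d f = S a b c f ∧
    S c a d f = S a b c f

/-- The triangle `x p0 q0` is crossed in the same direction by exactly the two edges
`p1 q1` and `p2 q2` of the complementary quadrilateral. -/
def Dbl (S : Fin 7 → Fin 7 → Fin 7 → Fin 7 → Bool) (x p0 q0 p1 q1 p2 q2 : Fin 7) : Prop :=
  Cr S x p0 q0 p1 q1 ∧ Cr S x p0 q0 p2 q2 ∧ ¬ Cr S x p0 q0 p1 q2 ∧ ¬ Cr S x p0 q0 p2 q1 ∧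
    S x p0 q0 p1 = S x p0 q0 p2

theorem no_135426 {S : Fin 7 → Fin 7 → Fin 7 → Fin 7 → Bool} (h : Chi S)
    (h1 : Dbl S 6 0 1 2 3 4 5) (h2 : Dbl S 6 0 3 2 1 4 5) : False := by
  simp (disch := decide) only [Dbl, Cr, h.s1, h.s2, h.s3] at h1 h2
  cases hb : S 0 1 2 6 <;> grind

theorem no_135462 {S : Fin 7 → Fin 7 → Fin 7 → Fin 7 → Bool} (h : Chi S)
    (h1 : Dbl S 6 0 1 2 3 4 5) (h2 : Dbl S 6 0 3 2 5 4 1) : False := by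
  simp (disch := decide) only [Dbl, Cr, h.s1, h.s2, h.s3] at h1 h2
  cases hb : S 0 1 2 6 <;> grind

theorem no_135624 {S : Fin 7 → Fin 7 → Fin 7 → Fin 7 → Bool} (h : Chi S)
    (h1 : Dbl S 6 0 1 2 3 4 5) (h2 : Dbl S 6 0 5 2 1 4 3) : False := by
  simp (disch := decide) only [Dbl, Cr, h.s1, h.s2, h.s3] at h1 h2
  cases hb : S 0 1 2 6 <;> grind

theorem no_135642 {S : Fin 7 → Fin 7 → Fin 7 → Fin 7 → Bool} (h : Chi S)
    (h1 : Dbl S 6 0 1 2 3 4 5) (h2 : Dbl S 6 0 5 2 3 4 1) : False := by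
  simp (disch := decide) only [Dbl, Cr, h.s1, h.s2, h.s3] at h1 h2
  cases hb : S 0 1 2 6 <;> grind

theorem no_153426 {S : Fin 7 → Fin 7 → Fin 7 → Fin 7 → Bool} (h : Chi S)
    (h1 : Dbl S 6 0 1 2 3 4 5) (h2 : Dbl S 6 0 3 4 1 2 5) : False := by
  simp (disch := decide) only [Dbl, Cr, h.s1, h.s2, h.s3] at h1 h2
  cases hb : S 0 1 2 6 <;> grind

theorem no_153462 {S : Fin 7 → Fin 7 → Fin 7 → Fin 7 → Bool} (h : Chi S)
    (h1 : Dbl S 6 0 1 2 3 4 5) (h2 : Dbl S 6 0 3 4 5 2 1) : False := by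
  simp (disch := decide) only [Dbl, Cr, h.s1, h.s2, h.s3] at h1 h2
  cases hb : S 0 1 2 6 <;> grind

theorem no_153624 {S : Fin 7 → Fin 7 → Fin 7 → Fin 7 → Bool} (h : Chi S)
    (h1 : Dbl S 6 0 1 2 3 4 5) (h2 : Dbl S 6 0 5 4 1 2 3) : False := by
  simp (disch := decide) only [Dbl, Cr, h.s1, h.s2, h.s3] at h1 h2
  cases hb : S 0 1 2 6 <;> grind

theorem no_153642 {S : Fin 7 → Fin 7 → Fin 7 → Fin 7 → Bool} (h : Chi S)
    (h1 : Dbl S 6 0 1 2 3 4 5) (h2 : Dbl S 6 0 5 4 3 2 1) : False := by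
  simp (disch := decide) only [Dbl, Cr, h.s1, h.s2, h.s3] at h1 h2
  cases hb : S 0 1 2 6 <;> grind

theorem no_315246 {S : Fin 7 → Fin 7 → Fin 7 → Fin 7 → Bool} (h : Chi S)
    (h1 : Dbl S 6 0 1 2 3 4 5) (h2 : Dbl S 6 2 1 0 3 4 5) : False := by
  simp (disch := decide) only [Dbl, Cr, h.s1, h.s2, h.s3] at h1 h2
  cases hb : S 0 1 2 6 <;> grind

theorem no_315264 {S : Fin 7 → Fin 7 → Fin 7 → Fin 7 → Bool} (h : Chi S)
    (h1 : Dbl S 6 0 1 2 3 4 5) (h2 : Dbl S 6 2 1 0 5 4 3) : False := by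
  simp (disch := decide) only [Dbl, Cr, h.s1, h.s2, h.s3] at h1 h2
  cases hb : S 0 1 2 6 <;> grind

theorem no_315426 {S : Fin 7 → Fin 7 → Fin 7 → Fin 7 → Bool} (h : Chi S)
    (h1 : Dbl S 6 0 1 2 3 4 5) (h2 : Dbl S 6 2 3 0 1 4 5) : False := by
  simp (disch := decide) only [Dbl, Cr, h.s1, h.s2, h.s3] at h1 h2
  cases hb : S 0 1 2 6 <;> grind

theorem no_315462 {S : Fin 7 → Fin 7 → Fin 7 → Fin 7 → Bool} (h : Chi S)
    (h1 : Dbl S 6 0 1 2 3 4 5) (h2 : Dbl S 6 2 3 0 5 4 1) : False := by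
  have g0 := h.gp 0 2 1 3 5 6 (by decide)
  have g1 := h.gp 0 3 1 2 5 6 (by decide)
  have g2 := h.gp 2 3 0 1 4 6 (by decide)
  have g3 := h.gp 2 3 0 1 5 6 (by decide)
  have g4 := h.gp 2 3 0 4 5 6 (by decide)
  have g5 := h.gp 1 5 0 2 3 6 (by decide)
  have g6 := h.gp 5 6 0 1 2 4 (by decide)
  have g7 := h.gp 5 6 0 1 3 4 (by decide)
  simp (disch := decide) only [Dbl, Cr, h.s1, h.s2, h.s3] at h1 h2 g0 g1 g2 g3 g4 g5 g6 g7
  cases hb : S 0 1 2 6 <;> first | grind | simp_all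

theorem no_315624 {S : Fin 7 → Fin 7 → Fin 7 → Fin 7 → Bool} (h : Chi S)
    (h1 : Dbl S 6 0 1 2 3 4 5) (h2 : Dbl S 6 2 5 0 1 4 3) : False := by
  have g0 := h.gp 0 1 2 3 5 6 (by decide)
  have g1 := h.gp 0 1 3 4 5 6 (by decide)
  have g2 := h.gp 0 2 1 3 5 6 (by decide)
  have g3 := h.gp 1 2 0 3 5 6 (by decide)
  have g4 := h.gp 3 5 0 1 2 6 (by decide)
  have g5 := h.gp 3 6 0 2 4 5 (by decide)
  have g6 := h.gp 3 6 1 2 4 5 (by decide)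
  simp (disch := decide) only [Dbl, Cr, h.s1, h.s2, h.s3] at h1 h2 g0 g1 g2 g3 g4 g5 g6
  cases hb : S 0 1 2 6 <;> first | grind | simp_all

theorem no_315642 {S : Fin 7 → Fin 7 → Fin 7 → Fin 7 → Bool} (h : Chi S)
    (h1 : Dbl S 6 0 1 2 3 4 5) (h2 : Dbl S 6 2 5 0 3 4 1) : False := by
  have g0 := h.gp 0 6 1 3 4 5 (by decide)
  have g1 := h.gp 1 4 0 2 5 6 (by decide)
  have g2 := h.gp 1 6 0 2 3 4 (by decide)
  have g3 := h.gp 0 1 2 3 4 6 (by decide)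
  simp (disch := decide) only [Dbl, Cr, h.s1, h.s2, h.s3] at h1 h2 g0 g1 g2 g3
  cases hb : S 0 1 2 6 <;> first | grind | simp_all

theorem no_351246 {S : Fin 7 → Fin 7 → Fin 7 → Fin 7 → Bool} (h : Chi S)
    (h1 : Dbl S 6 0 1 2 3 4 5) (h2 : Dbl S 6 2 1 4 3 0 5) : False := by
  simp (disch := decide) only [Dbl, Cr, h.s1, h.s2, h.s3] at h1 h2
  cases hb : S 0 1 2 6 <;> grind

theorem no_351264 {S : Fin 7 → Fin 7 → Fin 7 → Fin 7 → Bool} (h : Chi S)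
    (h1 : Dbl S 6 0 1 2 3 4 5) (h2 : Dbl S 6 2 1 4 5 0 3) : False := by
  simp (disch := decide) only [Dbl, Cr, h.s1, h.s2, h.s3] at h1 h2
  cases hb : S 0 1 2 6 <;> grind

theorem no_351426 {S : Fin 7 → Fin 7 → Fin 7 → Fin 7 → Bool} (h : Chi S)
    (h1 : Dbl S 6 0 1 2 3 4 5) (h2 : Dbl S 6 2 3 4 1 0 5) : False := by
  have g0 := h.gp 0 2 1 3 5 6 (by decide)
  have g1 := h.gp 0 3 1 2 5 6 (by decide)
  have g2 := h.gp 2 3 0 1 4 6 (by decide)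
  have g3 := h.gp 2 3 0 1 5 6 (by decide)
  have g4 := h.gp 2 3 0 4 5 6 (by decide)
  have g5 := h.gp 1 5 0 2 3 6 (by decide)
  have g6 := h.gp 5 6 0 1 2 4 (by decide)
  have g7 := h.gp 5 6 0 1 3 4 (by decide)
  simp (disch := decide) only [Dbl, Cr, h.s1, h.s2, h.s3] at h1 h2 g0 g1 g2 g3 g4 g5 g6 g7
  cases hb : S 0 1 2 6 <;> first | grind | simp_all

theorem no_351462 {S : Fin 7 → Fin 7 → Fin 7 → Fin 7 → Bool} (h : Chi S)
    (h1 : Dbl S 6 0 1 2 3 4 5) (h2 : Dbl S 6 2 3 4 5 0 1) : False := by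
  simp (disch := decide) only [Dbl, Cr, h.s1, h.s2, h.s3] at h1 h2
  cases hb : S 0 1 2 6 <;> grind

theorem no_351624 {S : Fin 7 → Fin 7 → Fin 7 → Fin 7 → Bool} (h : Chi S)
    (h1 : Dbl S 6 0 1 2 3 4 5) (h2 : Dbl S 6 2 5 4 1 0 3) : False := by
  have g0 := h.gp 0 6 1 3 4 5 (by decide)
  have g1 := h.gp 1 4 0 2 5 6 (by decide)
  have g2 := h.gp 1 6 0 2 3 4 (by decide)
  have g3 := h.gp 0 1 2 3 4 6 (by decide)
  simp (disch := decide) only [Dbl, Cr, h.s1, h.s2, h.s3] at h1 h2 g0 g1 g2 g3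
  cases hb : S 0 1 2 6 <;> first | grind | simp_all

theorem no_351642 {S : Fin 7 → Fin 7 → Fin 7 → Fin 7 → Bool} (h : Chi S)
    (h1 : Dbl S 6 0 1 2 3 4 5) (h2 : Dbl S 6 2 5 4 3 0 1) : False := by
  have g0 := h.gp 0 1 2 3 5 6 (by decide)
  have g1 := h.gp 0 1 2 4 5 6 (by decide)
  have g2 := h.gp 0 1 3 4 5 6 (by decide)
  have g3 := h.gp 0 2 1 3 5 6 (by decide)
  have g4 := h.gp 1 2 0 3 5 6 (by decide)
  have g5 := h.gp 1 5 0 2 4 6 (by decide)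
  have g6 := h.gp 1 2 0 3 4 6 (by decide)
  have g7 := h.gp 2 3 0 1 4 5 (by decide)
  have g8 := h.gp 2 4 0 1 3 6 (by decide)
  have g9 := h.gp 4 6 0 2 3 5 (by decide)
  have g10 := h.gp 4 6 1 2 3 5 (by decide)
  simp (disch := decide) only [Dbl, Cr, h.s1, h.s2, h.s3] at h1 h2 g0 g1 g2 g3 g4 g5 g6 g7 g8 g9 g10
  cases hb : S 0 1 2 6 <;> first | grind | simp_all

theorem no_513246 {S : Fin 7 → Fin 7 → Fin 7 → Fin 7 → Bool} (h : Chi S)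
    (h1 : Dbl S 6 0 1 2 3 4 5) (h2 : Dbl S 6 4 1 0 3 2 5) : False := by
  simp (disch := decide) only [Dbl, Cr, h.s1, h.s2, h.s3] at h1 h2
  cases hb : S 0 1 2 6 <;> grind

theorem no_513264 {S : Fin 7 → Fin 7 → Fin 7 → Fin 7 → Bool} (h : Chi S)
    (h1 : Dbl S 6 0 1 2 3 4 5) (h2 : Dbl S 6 4 1 0 5 2 3) : False := by
  simp (disch := decide) only [Dbl, Cr, h.s1, h.s2, h.s3] at h1 h2
  cases hb : S 0 1 2 6 <;> grind

theorem no_513426 {S : Fin 7 → Fin 7 → Fin 7 → Fin 7 → Bool} (h : Chi S)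
    (h1 : Dbl S 6 0 1 2 3 4 5) (h2 : Dbl S 6 4 3 0 1 2 5) : False := by
  have g0 := h.gp 0 1 2 3 4 6 (by decide)
  have g1 := h.gp 0 1 2 4 5 6 (by decide)
  have g2 := h.gp 0 1 3 4 5 6 (by decide)
  have g3 := h.gp 0 3 1 2 4 6 (by decide)
  have g4 := h.gp 0 4 1 3 5 6 (by decide)
  have g5 := h.gp 1 3 0 2 4 6 (by decide)
  have g6 := h.gp 0 3 1 2 5 6 (by decide)
  have g7 := h.gp 2 3 0 1 4 5 (by decide)
  have g8 := h.gp 3 5 0 1 2 6 (by decide)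
  have g9 := h.gp 5 6 0 2 3 4 (by decide)
  have g10 := h.gp 5 6 1 2 3 4 (by decide)
  simp (disch := decide) only [Dbl, Cr, h.s1, h.s2, h.s3] at h1 h2 g0 g1 g2 g3 g4 g5 g6 g7 g8 g9 g10
  cases hb : S 0 1 2 6 <;> first | grind | simp_all

theorem no_513462 {S : Fin 7 → Fin 7 → Fin 7 → Fin 7 → Bool} (h : Chi S)
    (h1 : Dbl S 6 0 1 2 3 4 5) (h2 : Dbl S 6 4 3 0 5 2 1) : False := by
  have g0 := h.gp 0 5 1 3 4 6 (by decide)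
  have g1 := h.gp 0 6 1 2 3 5 (by decide)
  have g2 := h.gp 1 6 0 2 4 5 (by decide)
  have g3 := h.gp 0 1 2 3 5 6 (by decide)
  simp (disch := decide) only [Dbl, Cr, h.s1, h.s2, h.s3] at h1 h2 g0 g1 g2 g3
  cases hb : S 0 1 2 6 <;> first | grind | simp_all

theorem no_513624 {S : Fin 7 → Fin 7 → Fin 7 → Fin 7 → Bool} (h : Chi S)
    (h1 : Dbl S 6 0 1 2 3 4 5) (h2 : Dbl S 6 4 5 0 1 2 3) : False := by
  simp (disch := decide) only [Dbl, Cr, h.s1, h.s2, h.s3] at h1 h2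
  cases hb : S 0 1 2 6 <;> grind

theorem no_513642 {S : Fin 7 → Fin 7 → Fin 7 → Fin 7 → Bool} (h : Chi S)
    (h1 : Dbl S 6 0 1 2 3 4 5) (h2 : Dbl S 6 4 5 0 3 2 1) : False := by
  have g0 := h.gp 1 4 0 2 5 6 (by decide)
  have g1 := h.gp 1 5 0 2 4 6 (by decide)
  have g2 := h.gp 4 5 0 1 2 6 (by decide)
  have g3 := h.gp 4 5 0 2 3 6 (by decide)
  have g4 := h.gp 0 2 1 4 5 6 (by decide)
  have g5 := h.gp 2 6 0 1 3 4 (by decide)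
  have g6 := h.gp 2 6 0 1 3 5 (by decide)
  simp (disch := decide) only [Dbl, Cr, h.s1, h.s2, h.s3] at h1 h2 g0 g1 g2 g3 g4 g5 g6
  cases hb : S 0 1 2 6 <;> first | grind | simp_all

theorem no_531246 {S : Fin 7 → Fin 7 → Fin 7 → Fin 7 → Bool} (h : Chi S)
    (h1 : Dbl S 6 0 1 2 3 4 5) (h2 : Dbl S 6 4 1 2 3 0 5) : False := by
  simp (disch := decide) only [Dbl, Cr, h.s1, h.s2, h.s3] at h1 h2
  cases hb : S 0 1 2 6 <;> grind

theorem no_531264 {S : Fin 7 → Fin 7 → Fin 7 → Fin 7 → Bool} (h : Chi S)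
    (h1 : Dbl S 6 0 1 2 3 4 5) (h2 : Dbl S 6 4 1 2 5 0 3) : False := by
  simp (disch := decide) only [Dbl, Cr, h.s1, h.s2, h.s3] at h1 h2
  cases hb : S 0 1 2 6 <;> grind

theorem no_531426 {S : Fin 7 → Fin 7 → Fin 7 → Fin 7 → Bool} (h : Chi S)
    (h1 : Dbl S 6 0 1 2 3 4 5) (h2 : Dbl S 6 4 3 2 1 0 5) : False := by
  have g0 := h.gp 0 5 1 3 4 6 (by decide)
  have g1 := h.gp 0 6 1 2 3 5 (by decide)
  have g2 := h.gp 1 6 0 2 4 5 (by decide)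
  have g3 := h.gp 0 1 2 3 5 6 (by decide)
  simp (disch := decide) only [Dbl, Cr, h.s1, h.s2, h.s3] at h1 h2 g0 g1 g2 g3
  cases hb : S 0 1 2 6 <;> first | grind | simp_all

theorem no_531462 {S : Fin 7 → Fin 7 → Fin 7 → Fin 7 → Bool} (h : Chi S)
    (h1 : Dbl S 6 0 1 2 3 4 5) (h2 : Dbl S 6 4 3 2 5 0 1) : False := by
  have g0 := h.gp 0 1 2 3 4 6 (by decide)
  have g1 := h.gp 0 1 2 4 5 6 (by decide)
  have g2 := h.gp 0 3 1 2 4 6 (by decide)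
  have g3 := h.gp 1 3 0 2 4 6 (by decide)
  have g4 := h.gp 2 4 0 1 3 6 (by decide)
  have g5 := h.gp 2 6 0 3 4 5 (by decide)
  have g6 := h.gp 2 6 1 3 4 5 (by decide)
  simp (disch := decide) only [Dbl, Cr, h.s1, h.s2, h.s3] at h1 h2 g0 g1 g2 g3 g4 g5 g6
  cases hb : S 0 1 2 6 <;> first | grind | simp_all

theorem no_531624 {S : Fin 7 → Fin 7 → Fin 7 → Fin 7 → Bool} (h : Chi S)
    (h1 : Dbl S 6 0 1 2 3 4 5) (h2 : Dbl S 6 4 5 2 1 0 3) : False := by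
  have g0 := h.gp 1 4 0 2 5 6 (by decide)
  have g1 := h.gp 1 5 0 2 4 6 (by decide)
  have g2 := h.gp 4 5 0 1 2 6 (by decide)
  have g3 := h.gp 4 5 0 2 3 6 (by decide)
  have g4 := h.gp 0 2 1 4 5 6 (by decide)
  have g5 := h.gp 2 6 0 1 3 4 (by decide)
  have g6 := h.gp 2 6 0 1 3 5 (by decide)
  simp (disch := decide) only [Dbl, Cr, h.s1, h.s2, h.s3] at h1 h2 g0 g1 g2 g3 g4 g5 g6
  cases hb : S 0 1 2 6 <;> first | grind | simp_all

theorem no_531642 {S : Fin 7 → Fin 7 → Fin 7 → Fin 7 → Bool} (h : Chi S)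
    (h1 : Dbl S 6 0 1 2 3 4 5) (h2 : Dbl S 6 4 5 2 3 0 1) : False := by
  simp (disch := decide) only [Dbl, Cr, h.s1, h.s2, h.s3] at h1 h2
  cases hb : S 0 1 2 6 <;> grind

/-- The orientation determinant of four points. -/
def B4 (a b c d : E3) : ℝ := det3 (b - a) (c - a) (d - a)

theorem B4_swap1 (a b c d : E3) : B4 a b c d = - B4 b a c d := by
  simp only [B4, det3, PiLp.sub_apply]; ring

theorem B4_swap2 (a b c d : E3) : B4 a b c d = - B4 a c b d := by
  simp only [B4, det3, PiLp.sub_apply]; ring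

theorem B4_swap3 (a b c d : E3) : B4 a b c d = - B4 a b d c := by
  simp only [B4, det3, PiLp.sub_apply]; ring

theorem B4_gp (a b c d e f : E3) :
    B4 a b c d * B4 a b e f - B4 a b c e * B4 a b d f + B4 a b c f * B4 a b d e = 0 := by
  simp only [B4, det3, PiLp.sub_apply]; ring

theorem B4_ne_zero {a b c d : E3} (h : AffineIndependent ℝ ![a, b, c, d]) :
    B4 a b c d ≠ 0 := by
  intro h0
  let M : Matrix (Fin 3) (Fin 3) ℝ := ![fun i => (b - a) i, fun i => (c - a) i, fun i => (d - a) i]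
  have hM : M.det = 0 := by
    rw [← h0, Matrix.det_fin_three]
    simp only [M, B4, det3, Matrix.cons_val]
    ring
  obtain ⟨w, hw, hz⟩ := Matrix.exists_vecMul_eq_zero_iff.mpr hM
  have hz' : ∀ i : Fin 3, w 0 * (b i - a i) + w 1 * (c i - a i) + w 2 * (d i - a i) = 0 := by
    intro i
    have := congrFun hz i
    simpa [Matrix.vecMul, dotProduct, Fin.sum_univ_three, M] using this
  rw [affineIndependent_iff] at h
  have key := h Finset.univ ![- w 0 - w 1 - w 2, w 0, w 1, w 2]
    (by simp [Fin.sum_univ_four]; ring) (by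
      ext i
      have := hz' i
      simp [Fin.sum_univ_four]
      linarith)
  apply hw
  funext i
  fin_cases i
  · simpa using key 1 (Finset.mem_univ _)
  · simpa using key 2 (Finset.mem_univ _)
  · simpa using key 3 (Finset.mem_univ _)

theorem pierce_signs {a b c d f : E3} (h : Pierces a b c d f) :
    ∃ s t α β γ : ℝ, 0 < s ∧ 0 < t ∧ 0 < α ∧ 0 < β ∧ 0 < γ ∧
      s * B4 a b c d = - (t * B4 a b c f) ∧ γ * B4 a b c f = s * B4 a b d f ∧
      α * B4 a b c f = s * B4 b c d f ∧ β * B4 a b c f = s * B4 c a d f := by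
  obtain ⟨x, ⟨s, t, hs, ht, hst, hx⟩, α, β, γ, hα, hβ, hγ, hsum, hx'⟩ := h
  have hxi : ∀ i : Fin 3, x i = s * d i + t * f i := by intro i; rw [← hx]; simp
  have hxi' : ∀ i : Fin 3, x i = α * a i + β * b i + γ * c i := by intro i; rw [hx']; simp
  have ht' : t = 1 - s := by linarith
  have hα' : α = 1 - β - γ := by linarith
  refine ⟨s, t, α, β, γ, hs, ht, hα, hβ, hγ, ?_, ?_, ?_, ?_⟩
  · have e1 : B4 a b c x = s * B4 a b c d + t * B4 a b c f := by
      simp only [B4, det3, PiLp.sub_apply, hxi, ht']; ring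
    have e2 : B4 a b c x = 0 := by
      simp only [B4, det3, PiLp.sub_apply, hxi', hα']; ring
    linarith
  · have e1 : B4 a b x f = s * B4 a b d f := by
      simp only [B4, det3, PiLp.sub_apply, hxi, ht']; ring
    have e2 : B4 a b x f = γ * B4 a b c f := by
      simp only [B4, det3, PiLp.sub_apply, hxi', hα']; ring
    linarith
  · have e1 : B4 b c x f = s * B4 b c d f := by
      simp only [B4, det3, PiLp.sub_apply, hxi, ht']; ring
    have e2 : B4 b c x f = α * B4 a b c f := by
      simp only [B4, det3, PiLp.sub_apply, hxi', hα']; ring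
    linarith
  · have e1 : B4 c a x f = s * B4 c a d f := by
      simp only [B4, det3, PiLp.sub_apply, hxi, ht']; ring
    have e2 : B4 c a x f = β * B4 a b c f := by
      simp only [B4, det3, PiLp.sub_apply, hxi', hα']; ring
    linarith

theorem pierces_of_pos {a b c d f : E3} (e : ℝ) (hd : 0 < - (e * B4 a b c d))
    (hf : 0 < e * B4 a b c f) (h1 : 0 < e * B4 a b d f) (h2 : 0 < e * B4 b c d f)
    (h3 : 0 < e * B4 c a d f) : Pierces a b c d f := by
  have hN : 0 < e * B4 a b c f - e * B4 a b c d := by linarith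
  have hN' := hN.ne'
  have hsum : e * B4 b c d f + e * B4 c a d f + e * B4 a b d f =
      e * B4 a b c f - e * B4 a b c d := by
    simp only [B4, det3, PiLp.sub_apply]; ring
  have hco : ∀ i : Fin 3, e * B4 a b c f * d i + -(e * B4 a b c d) * f i =
      e * B4 b c d f * a i + e * B4 c a d f * b i + e * B4 a b d f * c i := by
    intro i
    fin_cases i <;> simp only [B4, det3, PiLp.sub_apply] <;> simp <;> ring
  obtain ⟨N, hNdef⟩ : ∃ N, N = e * B4 a b c f - e * B4 a b c d := ⟨_, rfl⟩
  rw [← hNdef] at hN hN' hsum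
  refine ⟨(e * B4 a b c f / N) • d + (-(e * B4 a b c d) / N) • f,
    ⟨_, _, by positivity, by positivity, ?_, rfl⟩,
    e * B4 b c d f / N, e * B4 c a d f / N, e * B4 a b d f / N,
    by positivity, by positivity, by positivity, ?_, ?_⟩
  · rw [← add_div]; convert div_self hN' using 2; linarith
  · rw [← add_div, ← add_div, hsum, div_self hN']
  · ext i
    have := hco i
    simp only [PiLp.add_apply, PiLp.smul_apply, smul_eq_mul, div_mul_eq_mul_div, ← add_div]
    rw [this]

/-- The Boolean chirotope of seven points. -/
def chi (v : Fin 7 → E3) (i j k l : Fin 7) : Bool := decide (0 < B4 (v i) (v j) (v k) (v l))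

theorem not_sign {x y : ℝ} (h : x = -y) (hy : y ≠ 0) : decide (0 < x) = !decide (0 < y) := by
  rcases lt_or_gt_of_ne hy with h' | h'
  · have : 0 < x := by linarith
    simp [this, h'.le]
  · have : x ≤ 0 := by linarith
    simp [this, h']

theorem gp_sign {x y z w u t : ℝ} (hx : x ≠ 0) (hy : y ≠ 0) (hz : z ≠ 0) (hw : w ≠ 0)
    (hu : u ≠ 0) (ht : t ≠ 0) (h : x * y - z * w + u * t = 0) :
    ((decide (0 < x) == decide (0 < y)) = (decide (0 < u) == decide (0 < t)) →
      (decide (0 < z) == decide (0 < w)) = (decide (0 < x) == decide (0 < y))) := by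
  have aux : ∀ {p q : ℝ}, p ≠ 0 → q ≠ 0 → (decide (0 < p) == decide (0 < q)) = decide (0 < p * q) := by
    intro p q hp hq
    rcases lt_or_gt_of_ne hp with h1 | h1 <;> rcases lt_or_gt_of_ne hq with h2 | h2
    · simp [h1.not_gt, h2.not_gt, mul_pos_of_neg_of_neg h1 h2]
    · simp [h2]
    · simp [h1]
    · simp [h1, h2]
  rw [aux hx hy, aux hz hw, aux hu ht]
  have n1 := mul_ne_zero hx hy
  have n2 := mul_ne_zero hz hw
  have n3 := mul_ne_zero hu ht
  generalize x * y = p at *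
  generalize z * w = q at *
  generalize u * t = r at *
  intro hh
  rcases lt_or_gt_of_ne n1 with h1 | h1 <;> rcases lt_or_gt_of_ne n3 with h3 | h3
  · have : q < 0 := by linarith
    simp [this.not_gt, h1.not_gt]
  · simp [h3, h1.not_gt] at hh
  · simp [h1, h3.not_gt] at hh
  · have : 0 < q := by linarith
    simp [this, h1]

theorem chi_ne {v : Fin 7 → E3} (hv : GenPos7 v) {i j k l : Fin 7} (h : [i, j, k, l].Nodup) :
    B4 (v i) (v j) (v k) (v l) ≠ 0 := by
  simp only [List.nodup_cons, List.mem_cons, List.not_mem_nil, or_false, not_or] at h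
  obtain ⟨⟨h1, h2, h3⟩, ⟨h4, h5⟩, h6, -⟩ := h
  exact B4_ne_zero (hv i j k l h1 h2 h3 h4 h5 h6)

theorem nodup_sub {a b c d e f : Fin 7} (h : [a, b, c, d, e, f].Nodup) :
    [a, b, c, d].Nodup ∧ [a, b, e, f].Nodup ∧ [a, b, c, e].Nodup ∧ [a, b, d, f].Nodup ∧
      [a, b, c, f].Nodup ∧ [a, b, d, e].Nodup := by
  simp only [List.nodup_cons, List.mem_cons, List.not_mem_nil, or_false, not_or] at h ⊢
  tauto

theorem chi_Chi {v : Fin 7 → E3} (hv : GenPos7 v) : Chi (chi v) where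
  s1' _ _ _ _ h := not_sign (B4_swap1 _ _ _ _) (chi_ne hv (h.perm (List.Perm.swap _ _ _)))
  s2' _ _ _ _ h := not_sign (B4_swap2 _ _ _ _) (chi_ne hv (h.perm ((List.Perm.swap _ _ _).cons _)))
  s3' _ _ _ _ h := not_sign (B4_swap3 _ _ _ _)
    (chi_ne hv (h.perm (((List.Perm.swap _ _ _).cons _).cons _)))
  gp _ _ _ _ _ _ h := by
    obtain ⟨h1, h2, h3, h4, h5, h6⟩ := nodup_sub h
    exact gp_sign (chi_ne hv h1) (chi_ne hv h2) (chi_ne hv h3) (chi_ne hv h4) (chi_ne hv h5)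
      (chi_ne hv h6) (B4_gp _ _ _ _ _ _)

theorem Chi.comp {S : Fin 7 → Fin 7 → Fin 7 → Fin 7 → Bool} (h : Chi S) {π : Fin 7 → Fin 7}
    (hπ : Function.Injective π) : Chi (fun i j k l => S (π i) (π j) (π k) (π l)) where
  s1' _ _ _ _ hn := h.s1' _ _ _ _ (List.Nodup.map hπ hn)
  s2' _ _ _ _ hn := h.s2' _ _ _ _ (List.Nodup.map hπ hn)
  s3' _ _ _ _ hn := h.s3' _ _ _ _ (List.Nodup.map hπ hn)
  gp _ _ _ _ _ _ hn := h.gp _ _ _ _ _ _ (List.Nodup.map hπ hn)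

theorem pierces_iff {v : Fin 7 → E3} (hv : GenPos7 v) {a b c d f : Fin 7}
    (h : [a, b, c, d, f].Nodup) :
    Pierces (v a) (v b) (v c) (v d) (v f) ↔ Cr (chi v) a b c d f := by
  have hh : [a, b, c, d].Nodup ∧ [a, b, c, f].Nodup ∧ [a, b, d, f].Nodup ∧ [b, c, d, f].Nodup ∧
      [c, a, d, f].Nodup := by
    simp only [List.nodup_cons, List.mem_cons, List.not_mem_nil, or_false, not_or] at h ⊢
    tauto
  obtain ⟨m1, m2, m3, m4, m5⟩ := hh
  have n1 := chi_ne hv m1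
  have n2 := chi_ne hv m2
  have n3 := chi_ne hv m3
  have n4 := chi_ne hv m4
  have n5 := chi_ne hv m5
  unfold Cr chi
  constructor
  · intro hp
    obtain ⟨s, t, α, β, γ, hs, ht, hα, hβ, hγ, e1, e2, e3, e4⟩ := pierce_signs hp
    have aux : ∀ {p x y : ℝ}, 0 < p → p * y = s * x → decide (0 < x) = decide (0 < y) := by
      intro p x y hp' he
      have : 0 < x ↔ 0 < y := by
        rw [← mul_pos_iff_of_pos_left hs, ← he, mul_pos_iff_of_pos_left hp']
      simp [this]
    refine ⟨?_, aux hγ e2, aux hα e3, aux hβ e4⟩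
    rw [← not_sign rfl n2]
    refine aux ht ?_
    linarith
  · rintro ⟨e1, e2, e3, e4⟩
    rcases lt_or_gt_of_ne n2 with h2 | h2
    · simp only [h2.not_gt, decide_false, Bool.not_false, decide_eq_true_eq,
        decide_eq_false_iff_not, not_lt] at e1 e2 e3 e4
      have e2 := lt_of_le_of_ne e2 n3
      have e3 := lt_of_le_of_ne e3 n4
      have e4 := lt_of_le_of_ne e4 n5
      apply pierces_of_pos (-1) <;> linarith
    · simp only [h2, decide_true, Bool.not_true, decide_eq_true_eq,
        decide_eq_false_iff_not, not_lt] at e1 e2 e3 e4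
      have e1 := lt_of_le_of_ne e1 n1
      apply pierces_of_pos 1 <;> linarith

theorem Pierces_symm (A B C X Y : E3) : Pierces A B C X Y ↔ Pierces A B C Y X := by
  unfold Pierces; rw [openSegment_symm]

theorem edgeSign_eq {v : Fin 7 → E3} (hv : GenPos7 v) {a b c d f : Fin 7}
    (h : [a, b, c, d, f].Nodup) :
    edgeSign (v a) (v b) (v c) (v d) (v f) =
      if Cr (chi v) a b c d f then (if chi v a b c d then 1 else -1) else 0 := by
  unfold edgeSign
  rw [← pierces_iff hv h]
  by_cases hp : Pierces (v a) (v b) (v c) (v d) (v f) <;>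
    by_cases hd : 0 < det3 (v b - v a) (v c - v a) (v d - v a) <;> simp [chi, B4, hp, hd]

theorem sign_combi (P1 P2 P3 P4 : Prop) (s1 s2 s3 s4 : Bool) (h1 : P1 → s1 = !s2)
    (h2 : P2 → s2 = !s3) (h3 : P3 → s3 = !s4) (h4 : P4 → s4 = !s1)
    (h : ((if P1 then (if s1 then 1 else -1) else 0) + (if P2 then (if s2 then 1 else -1) else 0) +
      (if P3 then (if s3 then 1 else -1) else 0) +
      (if P4 then (if s4 then 1 else -1) else 0) : ℤ).natAbs = 2) :
    (P1 ∧ P3 ∧ ¬ P2 ∧ ¬ P4 ∧ s1 = s3) ∨ (P2 ∧ P4 ∧ ¬ P1 ∧ ¬ P3 ∧ s2 = s4) := by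
  by_cases P1 <;> by_cases P2 <;> by_cases P3 <;> by_cases P4 <;>
    cases s1 <;> cases s2 <;> cases s3 <;> cases s4 <;> grind

theorem lk_Dbl {v : Fin 7 → E3} (hv : GenPos7 v) {x p0 q0 p1 q1 p2 q2 : Fin 7}
    (hn : [x, p0, q0, p1, q1, p2, q2].Nodup)
    (h : (lkTriQuad (v x) (v p0) (v q0) (v p1) (v q1) (v p2) (v q2)).natAbs = 2) :
    Dbl (chi v) x p0 q0 p1 q1 p2 q2 ∨ Dbl (chi v) x p0 q0 p1 q2 p2 q1 := by
  have hh : [x, p0, q0, p1, q1].Nodup ∧ [x, p0, q0, q1, p2].Nodup ∧ [x, p0, q0, p2, q2].Nodup ∧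
      [x, p0, q0, q2, p1].Nodup ∧ [x, p0, q0, p2, q1].Nodup ∧ [x, p0, q0, p1, q2].Nodup := by
    simp only [List.nodup_cons, List.mem_cons, List.not_mem_nil, or_false, not_or] at hn ⊢
    grind
  obtain ⟨m1, m2, m3, m4, m5, m6⟩ := hh
  have c1 : Cr (chi v) x p0 q0 q1 p2 ↔ Cr (chi v) x p0 q0 p2 q1 := by
    rw [← pierces_iff hv m2, ← pierces_iff hv m5, Pierces_symm]
  have c2 : Cr (chi v) x p0 q0 q2 p1 ↔ Cr (chi v) x p0 q0 p1 q2 := by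
    rw [← pierces_iff hv m4, ← pierces_iff hv m6, Pierces_symm]
  unfold lkTriQuad at h
  rw [edgeSign_eq hv m1, edgeSign_eq hv m2, edgeSign_eq hv m3, edgeSign_eq hv m4] at h
  have := sign_combi _ _ _ _ _ _ _ _ (fun h => h.1) (fun h => h.1) (fun h => h.1)
    (fun h => h.1) h
  rcases this with ⟨a1, a2, a3, a4, a5⟩ | ⟨a1, a2, a3, a4, a5⟩
  · exact Or.inl ⟨a1, a2, fun h => a4 (c2.mpr h), fun h => a3 (c1.mpr h), a5⟩
  · refine Or.inr ⟨c2.mp a2, c1.mp a1, a3, a4, ?_⟩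
    have b1 := a1.1
    have b2 := a2.1
    rw [a5] at b1
    rw [b1] at b2
    simpa using b2.symm

theorem perm3_cases (ρ : Equiv.Perm (Fin 3)) :
    (ρ 0 = 0 ∧ ρ 1 = 1 ∧ ρ 2 = 2) ∨ (ρ 0 = 0 ∧ ρ 1 = 2 ∧ ρ 2 = 1) ∨
    (ρ 0 = 1 ∧ ρ 1 = 0 ∧ ρ 2 = 2) ∨ (ρ 0 = 1 ∧ ρ 1 = 2 ∧ ρ 2 = 0) ∨
    (ρ 0 = 2 ∧ ρ 1 = 0 ∧ ρ 2 = 1) ∨ (ρ 0 = 2 ∧ ρ 1 = 1 ∧ ρ 2 = 0) := by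
  revert ρ; decide

/-- `Dbl` for the labelling of `K₃,₃` given by two permutations. -/
def DblP (S : Fin 7 → Fin 7 → Fin 7 → Fin 7 → Bool) (σ τ : Equiv.Perm (Fin 3)) : Prop :=
  Dbl S 6 (odds (σ 0)) (evens (τ 0)) (odds (σ 1)) (evens (τ 1)) (odds (σ 2)) (evens (τ 2))

theorem core {S : Fin 7 → Fin 7 → Fin 7 → Fin 7 → Bool} (h : Chi S)
    (h1 : Dbl S 6 0 1 2 3 4 5) (ρ κ : Equiv.Perm (Fin 3)) (h2 : DblP S ρ κ) :
    ρ 0 = 0 ∧ κ 0 = 0 := by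
  unfold DblP at h2
  rcases perm3_cases ρ with ⟨a, b, c⟩ | ⟨a, b, c⟩ | ⟨a, b, c⟩ | ⟨a, b, c⟩ | ⟨a, b, c⟩ | ⟨a, b, c⟩ <;>
  rcases perm3_cases κ with ⟨d, e, f⟩ | ⟨d, e, f⟩ | ⟨d, e, f⟩ | ⟨d, e, f⟩ | ⟨d, e, f⟩ | ⟨d, e, f⟩ <;>
  simp only [a, b, c, d, e, f, odds, evens, Matrix.cons_val] at h2 <;>
  first | exact ⟨a, d⟩ |
    exact (no_135426 h h1 h2).elim |
    exact (no_135462 h h1 h2).elim |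
    exact (no_135624 h h1 h2).elim |
    exact (no_135642 h h1 h2).elim |
    exact (no_153426 h h1 h2).elim |
    exact (no_153462 h h1 h2).elim |
    exact (no_153624 h h1 h2).elim |
    exact (no_153642 h h1 h2).elim |
    exact (no_315246 h h1 h2).elim |
    exact (no_315264 h h1 h2).elim |
    exact (no_315426 h h1 h2).elim |
    exact (no_315462 h h1 h2).elim |
    exact (no_315624 h h1 h2).elim |
    exact (no_315642 h h1 h2).elim |
    exact (no_351246 h h1 h2).elim |
    exact (no_351264 h h1 h2).elim |
    exact (no_351426 h h1 h2).elim |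
    exact (no_351462 h h1 h2).elim |
    exact (no_351624 h h1 h2).elim |
    exact (no_351642 h h1 h2).elim |
    exact (no_513246 h h1 h2).elim |
    exact (no_513264 h h1 h2).elim |
    exact (no_513426 h h1 h2).elim |
    exact (no_513462 h h1 h2).elim |
    exact (no_513624 h h1 h2).elim |
    exact (no_513642 h h1 h2).elim |
    exact (no_531246 h h1 h2).elim |
    exact (no_531264 h h1 h2).elim |
    exact (no_531426 h h1 h2).elim |
    exact (no_531462 h h1 h2).elim |
    exact (no_531624 h h1 h2).elim |
    exact (no_531642 h h1 h2).elim

theorem core' {S : Fin 7 → Fin 7 → Fin 7 → Fin 7 → Bool} (h : Chi S)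
    (σ τ σ' τ' : Equiv.Perm (Fin 3)) (h1 : DblP S σ τ) (h2 : DblP S σ' τ') :
    σ' 0 = σ 0 ∧ τ' 0 = τ 0 := by
  let π : Fin 7 → Fin 7 :=
    ![odds (σ 0), evens (τ 0), odds (σ 1), evens (τ 1), odds (σ 2), evens (τ 2), 6]
  have hπ : Function.Injective π := by
    simp only [π]
    rcases perm3_cases σ with ⟨a, b, c⟩ | ⟨a, b, c⟩ | ⟨a, b, c⟩ | ⟨a, b, c⟩ | ⟨a, b, c⟩ | ⟨a, b, c⟩ <;>
    rcases perm3_cases τ with ⟨d, e, f⟩ | ⟨d, e, f⟩ | ⟨d, e, f⟩ | ⟨d, e, f⟩ | ⟨d, e, f⟩ | ⟨d, e, f⟩ <;>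
    rw [a, b, c, d, e, f] <;> decide
  have ho : ∀ i, odds (σ i) = π (odds i) := by intro i; fin_cases i <;> rfl
  have he : ∀ i, evens (τ i) = π (evens i) := by intro i; fin_cases i <;> rfl
  have key := core (h.comp hπ) h1 (σ'.trans σ.symm) (τ'.trans τ.symm) (by
    have ho' : ∀ i, odds (σ' i) = π (odds (σ.symm (σ' i))) := by intro i; rw [← ho]; simp
    have he' : ∀ i, evens (τ' i) = π (evens (τ.symm (τ' i))) := by intro i; rw [← he]; simp
    unfold DblP at h2
    simp only [ho', he'] at h2
    exact h2)
  simpa [Equiv.symm_apply_eq] using key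

theorem lk331_DblP {v : Fin 7 → E3} (hv : GenPos7 v) (a b : Fin 3)
    (h : (lk331 v a b).natAbs = 2) :
    ∃ σ τ : Equiv.Perm (Fin 3), σ 0 = a ∧ τ 0 = b ∧ DblP (chi v) σ τ := by
  have hn : [6, odds a, evens b, odds (a + 1), evens (b + 1), odds (a + 2), evens (b + 2)].Nodup := by
    clear h; revert a b; decide
  have w1 : Equiv.swap (1 : Fin 3) 2 0 = 0 := by decide
  rcases lk_Dbl hv hn h with hD | hD
  · exact ⟨Equiv.addLeft a, Equiv.addLeft b, by simp, by simp, by simpa [DblP] using hD⟩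
  · exact ⟨Equiv.addLeft a, (Equiv.swap 1 2).trans (Equiv.addLeft b), by simp, by simp [w1],
      by simpa [DblP, w1] using hD⟩

/-- In any linear embedding of `K₃,₃,₁` in `ℝ³` (vertices in general position,
straight edges), at most one of the nine 2-component links has linking number 2
(in absolute value). -/
theorem at_most_one_double_link (v : Fin 7 → E3) (hGP : GenPos7 v) :
    ∀ p q : Fin 3 × Fin 3, p ≠ q →
      ¬ ((lk331 v p.1 p.2).natAbs = 2 ∧ (lk331 v q.1 q.2).natAbs = 2) := by
  rintro ⟨a, b⟩ ⟨c, d⟩ hne ⟨h1, h2⟩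
  obtain ⟨σ, τ, rfl, rfl, k1⟩ := lk331_DblP hGP a b h1
  obtain ⟨σ', τ', rfl, rfl, k2⟩ := lk331_DblP hGP c d h2
  obtain ⟨e1, e2⟩ := core' (chi_Chi hGP) σ τ σ' τ' k1 k2
  exact hne (by rw [e1, e2])

end
end

section
/- A geodesic immersion of K_{3,3} in the 2-sphere with exactly 9 crossings has a unique crossing pattern up to relabeling: the crossing pairs of edges are (14,32), (16,32), (14,52), (16,52), (14,36), (14,56), (32,54), (32,56), (36,54), and the edges 12 and 34 have no crossings. -/
open scoped Classical

noncomputable section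

/-- The interior of the shortest geodesic arc joining `X` and `Y` on the unit
sphere: normalizations of strictly positive combinations of `X` and `Y`. -/
def ArcInt (X Y : E3) : Set E3 :=
  {z | ∃ a b : ℝ, 0 < a ∧ 0 < b ∧ z = ‖a • X + b • Y‖⁻¹ • (a • X + b • Y)}

/-- Two geodesic edges `XY` and `ZW` on the sphere cross if they share a point
interior to both. -/
def Crosses (X Y Z W : E3) : Prop := (ArcInt X Y ∩ ArcInt Z W).Nonempty

/-- Vertices of `K₃,₃`: indices `0,2,4` form one part (labels `1,3,5`). -/
def oI : Fin 3 → Fin 6 := ![0, 2, 4]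

/-- Indices `1,3,5` form the other part (labels `2,4,6`). -/
def eI : Fin 3 → Fin 6 := ![1, 3, 5]

/-- A geodesic immersion of `K₃,₃` in the unit sphere: all vertices are unit
vectors and no three of them lie on a common great circle. -/
def GoodImm (v : Fin 6 → E3) : Prop :=
  (∀ i, ‖v i‖ = 1) ∧
    ∀ i j k : Fin 6, i ≠ j → i ≠ k → j ≠ k → LinearIndependent ℝ ![v i, v j, v k]

/-- The number of crossings of the immersion: the number of unordered pairs of
disjoint edges whose geodesic arcs cross.  An edge is a pair `(a, b)`, joining
vertex `oI a` to vertex `eI b`. -/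
def crossingCount (v : Fin 6 → E3) : ℕ :=
  (Finset.univ.filter fun p : (Fin 3 × Fin 3) × (Fin 3 × Fin 3) =>
    p.1.1 < p.2.1 ∧ p.1.2 ≠ p.2.2 ∧
      Crosses (v (oI p.1.1)) (v (eI p.1.2)) (v (oI p.2.1)) (v (eI p.2.2))).card

/-- The edge `(a,b)` of `K₃,₃` has no crossings with any other edge. -/
def EdgeFree (v : Fin 6 → E3) (p : Fin 3 × Fin 3) : Prop :=
  ∀ q : Fin 3 × Fin 3, q ≠ p →
    ¬ Crosses (v (oI p.1)) (v (eI p.2)) (v (oI q.1)) (v (eI q.2))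

/-- The nine crossing pairs of edges, in the vertex labels of the paper
(label `ℓ` is index `ℓ - 1`; parts are labels `{1,3,5}` and `{2,4,6}`):
`(14,32), (16,32), (14,52), (16,52), (14,36), (14,56), (32,54), (32,56), (36,54)`. -/
def Pattern : Set ((Fin 6 × Fin 6) × (Fin 6 × Fin 6)) :=
  {((0,3),(2,1)), ((0,5),(2,1)), ((0,3),(4,1)), ((0,5),(4,1)), ((0,3),(2,5)),
   ((0,3),(4,5)), ((2,1),(4,3)), ((2,1),(4,5)), ((2,5),(4,3))}

/-- Determinant of three vectors. -/
def D3 (X Y Z : E3) : ℝ :=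
  X 0 * (Y 1 * Z 2 - Y 2 * Z 1) - X 1 * (Y 0 * Z 2 - Y 2 * Z 0) + X 2 * (Y 0 * Z 1 - Y 1 * Z 0)

lemma D3_ne {X Y Z : E3} (h : LinearIndependent ℝ ![X, Y, Z]) : D3 X Y Z ≠ 0 := by
  have h2 := h.map' (WithLp.linearEquiv 2 ℝ (Fin 3 → ℝ)).toLinearMap
    (LinearEquiv.ker _)
  have h3 : LinearIndependent ℝ (Matrix.row (Matrix.of fun i j => (![X, Y, Z] i) j)) := by
    exact h2
  rw [Matrix.linearIndependent_rows_iff_isUnit, Matrix.isUnit_iff_isUnit_det, Matrix.det_fin_three,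
    isUnit_iff_ne_zero] at h3
  simp at h3
  intro h0
  apply h3
  unfold D3 at h0
  linarith

lemma crosses_elim {X Y Z W : E3} (hXY : LinearIndependent ℝ ![X, Y])
    (h : Crosses X Y Z W) :
    ∃ a b c d : ℝ, 0 < a ∧ 0 < b ∧ 0 < c ∧ 0 < d ∧ ∀ i, a * X i + b * Y i = c * Z i + d * W i := by
  obtain ⟨z, ⟨a, b, ha, hb, hz⟩, ⟨c, d, hc, hd, hz'⟩⟩ := h
  have hu : a • X + b • Y ≠ 0 := by
    intro h0
    have := LinearIndependent.pair_iff.1 hXY a b h0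
    exact ha.ne' this.1
  have hn : 0 < ‖a • X + b • Y‖⁻¹ := by positivity
  have hz0 : z ≠ 0 := by
    rw [hz]; exact smul_ne_zero hn.ne' hu
  have hm : 0 < ‖c • Z + d • W‖⁻¹ := by
    rcases eq_or_ne (c • Z + d • W) 0 with h0 | h0
    · rw [h0] at hz'; simp at hz'; exact absurd hz' hz0
    · positivity
  refine ⟨_ * a, _ * b, _ * c, _ * d, mul_pos hn ha, mul_pos hn hb, mul_pos hm hc, mul_pos hm hd, ?_⟩
  intro i
  have := congrArg (fun x : E3 => x i) (hz.symm.trans hz')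
  simp at this
  linarith

lemma opp_sign {a b x y : ℝ} (ha : 0 < a) (hb : 0 < b) (hx : x ≠ 0)
    (h : a * x + b * y = 0) : (0 < x ↔ ¬ 0 < y) := by
  constructor
  · intro h1 h2
    nlinarith [mul_pos ha h1, mul_pos hb h2]
  · intro h1
    by_contra h2
    have h3 : x < 0 := lt_of_le_of_ne (not_lt.1 h2) hx
    nlinarith [mul_pos_of_neg_of_neg (neg_lt_zero.2 ha) h3, mul_nonneg hb.le (neg_nonneg.2 (not_lt.1 h1))]

/-- Sign of the determinant as a Boolean. -/
def sB (X Y Z : E3) : Bool := decide (0 < D3 X Y Z)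

/-- Crossing criterion on four signs. -/
def crB (q p r t : Bool) : Bool := (q != p) && ((q != r) && (q == t))

/-- Grassmann–Plücker condition on six signs. -/
def gpB (p p' q q' r r' : Bool) : Bool :=
  !(((p == p') != (q == q')) && ((p == p') == (r == r')))

lemma crosses_intro {X Y Z W : E3} {a b c d : ℝ} (ha : 0 < a) (hb : 0 < b) (hc : 0 < c)
    (hd : 0 < d) (h : ∀ i, a * X i + b * Y i = c * Z i + d * W i) : Crosses X Y Z W := by
  have : a • X + b • Y = c • Z + d • W := by
    ext i; simpa using h i
  exact ⟨_, ⟨a, b, ha, hb, rfl⟩, ⟨c, d, hc, hd, by rw [this]⟩⟩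

lemma cramer (X Y Z W : E3) (i : Fin 3) :
    D3 Y Z W * X i - D3 X Z W * Y i + D3 X Y W * Z i - D3 X Y Z * W i = 0 := by
  fin_cases i <;> simp [D3] <;> ring

lemma crosses_iff {X Y Z W : E3} (hXY : LinearIndependent ℝ ![X, Y])
    (h1 : D3 Y Z W ≠ 0) (h2 : D3 X Z W ≠ 0) (h3 : D3 X Y W ≠ 0) (h4 : D3 X Y Z ≠ 0) :
    Crosses X Y Z W ↔ crB (sB Y Z W) (sB X Z W) (sB X Y W) (sB X Y Z) = true := by
  constructor
  · intro h
    obtain ⟨a, b, c, d, ha, hb, hc, hd, h⟩ := crosses_elim hXY h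
    have e0 := h 0
    have e1 := h 1
    have e2 := h 2
    have k1 : a * D3 X Z W + b * D3 Y Z W = 0 := by
      unfold D3
      linear_combination (Z 1 * W 2 - Z 2 * W 1) * e0 - (Z 0 * W 2 - Z 2 * W 0) * e1
        + (Z 0 * W 1 - Z 1 * W 0) * e2
    have k2 : c * D3 X Y Z + d * D3 X Y W = 0 := by
      unfold D3
      linear_combination -(X 1 * Y 2 - X 2 * Y 1) * e0 + (X 0 * Y 2 - X 2 * Y 0) * e1
        - (X 0 * Y 1 - X 1 * Y 0) * e2
    have k3 : a * D3 X Y W + c * D3 Y Z W = 0 := by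
      unfold D3
      linear_combination (Y 1 * W 2 - Y 2 * W 1) * e0 - (Y 0 * W 2 - Y 2 * W 0) * e1
        + (Y 0 * W 1 - Y 1 * W 0) * e2
    have s1 := opp_sign ha hb h2 k1
    have s2 := opp_sign hc hd h4 k2
    have s3 := opp_sign ha hc h3 k3
    simp only [crB, sB]
    by_cases t1 : 0 < D3 Y Z W <;> by_cases t2 : 0 < D3 X Z W <;> by_cases t3 : 0 < D3 X Y W <;>
      by_cases t4 : 0 < D3 X Y Z <;> simp only [t1, t2, t3, t4] at s1 s2 s3 ⊢ <;> revert s1 s2 s3 <;>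
      decide
  · intro h
    have key := cramer X Y Z W
    simp only [crB, sB] at h
    by_cases t1 : 0 < D3 Y Z W
    · have t2 : D3 X Z W < 0 := lt_of_le_of_ne (by simp_all) h2
      have t3 : D3 X Y W < 0 := lt_of_le_of_ne (by simp_all) h3
      have t4 : 0 < D3 X Y Z := by simp_all
      exact crosses_intro t1 (neg_pos.2 t2) (neg_pos.2 t3) t4
        (fun i => by linear_combination key i)
    · have t1' : D3 Y Z W < 0 := lt_of_le_of_ne (not_lt.1 t1) h1
      have t2 : 0 < D3 X Z W := by simp_all
      have t3 : 0 < D3 X Y W := by simp_all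
      have t4 : D3 X Y Z < 0 := lt_of_le_of_ne (by simp_all) h4
      exact crosses_intro (neg_pos.2 t1') t2 t3 (neg_pos.2 t4)
        (fun i => by linear_combination -key i)

lemma gp_real (A B C D E : E3) :
    D3 A B C * D3 A D E - D3 A B D * D3 A C E + D3 A B E * D3 A C D = 0 := by
  unfold D3; ring

lemma mul_sign {x y : ℝ} (hx : x ≠ 0) (hy : y ≠ 0) :
    (0 < x * y ∧ (decide (0 < x) == decide (0 < y)) = true) ∨
    (x * y < 0 ∧ (decide (0 < x) == decide (0 < y)) = false) := by
  rcases lt_or_gt_of_ne hx with h | h <;> rcases lt_or_gt_of_ne hy with h' | h'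
  · left; exact ⟨mul_pos_of_neg_of_neg h h', by simp [h.not_gt, h'.not_gt]⟩
  · right; exact ⟨mul_neg_of_neg_of_pos h h', by simp [h.not_gt, h']⟩
  · right; exact ⟨mul_neg_of_pos_of_neg h h', by simp [h, h'.not_gt]⟩
  · left; exact ⟨mul_pos h h', by simp [h, h']⟩

lemma gp_sign_s14 {A B C D E : E3} (h1 : D3 A B C ≠ 0) (h2 : D3 A D E ≠ 0) (h3 : D3 A B D ≠ 0)
    (h4 : D3 A C E ≠ 0) (h5 : D3 A B E ≠ 0) (h6 : D3 A C D ≠ 0) :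
    gpB (sB A B C) (sB A D E) (sB A B D) (sB A C E) (sB A B E) (sB A C D) = true := by
  have h := gp_real A B C D E
  unfold gpB sB
  rcases mul_sign h1 h2 with ⟨p, p'⟩ | ⟨p, p'⟩ <;> rcases mul_sign h3 h4 with ⟨q, q'⟩ | ⟨q, q'⟩ <;>
    rcases mul_sign h5 h6 with ⟨r, r'⟩ | ⟨r, r'⟩ <;> rw [p', q', r'] <;> first | rfl | (exfalso; linarith)

/-- Lookup of the sign of a sorted triple (colexicographic order). -/
def lkB (L : List Bool) (i j k : ℕ) : Bool :=
  L.getD (k * (k - 1) * (k - 2) / 6 + j * (j - 1) / 2 + i) false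

/-- Alternating extension of the lookup. -/
def sgB (L : List Bool) (i j k : ℕ) : Bool :=
  bif Nat.blt i j then
    bif Nat.blt j k then lkB L i j k else bif Nat.blt i k then !lkB L i k j else lkB L k i j
  else
    bif Nat.blt i k then !lkB L j i k else bif Nat.blt j k then lkB L j k i else !lkB L k j i

/-- Crossing of the edges `ij` and `kl` from the list of signs. -/
def crL (L : List Bool) (i j k l : Fin 6) : Bool :=
  crB (sgB L j k l) (sgB L i k l) (sgB L i j l) (sgB L i j k)

def perms3 : List (ℕ × ℕ × ℕ) :=
  [(0, 1, 2), (0, 2, 1), (1, 0, 2), (1, 2, 0), (2, 0, 1), (2, 1, 0)]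

/-- The 72 automorphisms of the graph. -/
def autB : List (Fin 6 → Fin 6) :=
  perms3.flatMap fun p => perms3.flatMap fun q => [0, 1].map fun w => fun i =>
    Fin.ofNat 6 ([2 * p.1 + w, 2 * q.1 + (1 - w), 2 * p.2.1 + w, 2 * q.2.1 + (1 - w),
      2 * p.2.2 + w, 2 * q.2.2 + (1 - w)].getD i.val 0)

/-- Boolean version of the pattern. -/
def patB (a b c d : Fin 6) : Bool :=
  [((0,3),(2,1)), ((0,5),(2,1)), ((0,3),(4,1)), ((0,5),(4,1)), ((0,3),(2,5)),
   ((0,3),(4,5)), ((2,1),(4,3)), ((2,1),(4,5)), ((2,5),(4,3))].any fun (p : (ℕ × ℕ) × (ℕ × ℕ)) =>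
     (Nat.beq p.1.1 a && (Nat.beq p.1.2 b && (Nat.beq p.2.1 c && Nat.beq p.2.2 d))) ||
     (Nat.beq p.1.1 c && (Nat.beq p.1.2 d && (Nat.beq p.2.1 a && Nat.beq p.2.2 b)))

def l3 : List (Fin 3) := [0, 1, 2]

def finB (L : List Bool) : Bool :=
  autB.any fun r => l3.all fun a => l3.all fun b => l3.all fun c => l3.all fun d =>
    (Nat.beq a c || Nat.beq b d) ||
      (crL L (r (oI a)) (r (eI b)) (r (oI c)) (r (eI d)) == patB (oI a) (eI b) (oI c) (eI d))

set_option maxRecDepth 100000 in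
theorem k33_comb :
    ∀ b012 b013 b023 b123 : Bool,
    ((crB b123 b023 b013 b012) || (crB (!b123) (!b012) (!b013) (!b023))) = true →
    ∀ b015 b025 b125 : Bool,
    ((crB b125 b025 b015 b012) || (crB (!b125) (!b012) (!b015) (!b025))) = true →
    ∀ b035 b235 : Bool,
    ((crB (!b235) b025 b035 (!b023)) || (crB b235 b023 (!b035) (!b025))) = true →
    gpB b012 b035 b013 b025 b015 b023 = true →
    ∀ b014 b034 b134 : Bool,
    ((crB (!b134) (!b034) b013 b014) || (crB b134 (!b014) (!b013) b034)) = true →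
    ∀ b124 b234 : Bool,
    ((crB (!b134) (!b234) (!b123) (!b124)) || (crB b134 b124 b123 b234)) = true →
    gpB (!b012) b134 (!b013) b124 (!b014) b123 = true →
    ∀ b045 b145 : Bool,
    ((crB b145 b045 b015 b014) || (crB (!b145) (!b014) (!b015) (!b045))) = true →
    ∀ b345 : Bool,
    ((crB b345 b045 b035 b034) || (crB (!b345) (!b034) (!b035) (!b045))) = true →
    ∀ b245 : Bool,
    ((crB b145 b245 (!b125) (!b124)) || (crB (!b145) b124 b125 (!b245))) = true →
    ((crB b345 b245 b235 b234) || (crB (!b345) (!b234) (!b235) (!b245))) = true →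
    ∀ b024 b135 : Bool,
    finB [b012, b013, b023, b123, b014, b024, b124, b034, b134, b234, b015, b025, b125, b035, b135, b235, b045, b145, b245, b345] = true := by
  decide +kernel


lemma patB_iff : ∀ a b c d : Fin 3, patB (oI a) (eI b) (oI c) (eI d) = true ↔
    (((oI a, eI b), (oI c, eI d)) ∈ Pattern ∨ ((oI c, eI d), (oI a, eI b)) ∈ Pattern) := by
  simp only [Pattern, Set.mem_insert_iff, Set.mem_singleton_iff, Prod.mk.injEq]
  intro a b c d
  fin_cases a <;> fin_cases b <;> fin_cases c <;> fin_cases d <;> simp [patB, oI, eI]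

def l6 : List (Fin 6) := [0, 1, 2, 3, 4, 5]

def autOk (r : Fin 6 → Fin 6) : Bool :=
  l6.all fun i => l6.all fun j => (!(Nat.beq (r i) (r j)) || Nat.beq i j) &&
    ((Nat.beq ((r i).val % 2) ((r j).val % 2)) == (Nat.beq (i.val % 2) (j.val % 2)))

lemma autB_ok : autB.all autOk = true := by decide +kernel

lemma l6_mem : ∀ a : Fin 6, a ∈ l6 := by decide +kernel

lemma autB_prop (r : Fin 6 → Fin 6) (hr : r ∈ autB) : (∀ i j, r i = r j → i = j) ∧
    (∀ i j : Fin 6, ((r i).val % 2 = (r j).val % 2 ↔ i.val % 2 = j.val % 2)) := by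
  have h := List.all_eq_true.1 autB_ok r hr
  unfold autOk at h
  simp only [List.all_eq_true] at h
  have h' := fun i j => h i (l6_mem i) j (l6_mem j)
  simp only [Bool.and_eq_true, Bool.or_eq_true, beq_iff_eq, Bool.not_eq_true'] at h'
  constructor
  · intro i j hij
    rcases (h' i j).1 with h1 | h1
    · rw [hij] at h1
      exact absurd (h1.symm.trans (Nat.beq_refl _)) (by decide)
    · exact Fin.ext (Nat.eq_of_beq_eq_true h1)
  · intro i j
    have h2 := (h' i j).2
    rw [← Nat.beq_eq, ← Nat.beq_eq, h2]

lemma l3_mem : ∀ a : Fin 3, a ∈ l3 := by decide +kernel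

lemma finB_spec {L : List Bool} (h : finB L = true) :
    ∃ ρ : Fin 6 ≃ Fin 6,
      (∀ i j : Fin 6, ((ρ i).val % 2 = (ρ j).val % 2 ↔ i.val % 2 = j.val % 2)) ∧
      ∀ a b c d : Fin 3, a ≠ c → b ≠ d →
        crL L (ρ (oI a)) (ρ (eI b)) (ρ (oI c)) (ρ (eI d)) = patB (oI a) (eI b) (oI c) (eI d) := by
  unfold finB at h
  rw [List.any_eq_true] at h
  obtain ⟨r, hr, h⟩ := h
  obtain ⟨hi, hp⟩ := autB_prop r hr
  refine ⟨Equiv.ofBijective r (Finite.injective_iff_bijective.1 (fun i j => hi i j)), hp, ?_⟩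
  intro a b c d hac hbd
  simp only [List.all_eq_true] at h
  have := h a (l3_mem a) b (l3_mem b) c (l3_mem c) d (l3_mem d)
  have hac' : Nat.beq a c = false := by
    rw [Bool.eq_false_iff]; intro h; exact hac (Fin.ext (Nat.eq_of_beq_eq_true h))
  have hbd' : Nat.beq b d = false := by
    rw [Bool.eq_false_iff]; intro h; exact hbd (Fin.ext (Nat.eq_of_beq_eq_true h))
  rw [hac', hbd'] at this
  simpa using this

/-- The list of actual signs. -/
def LL (s : Fin 6 → Fin 6 → Fin 6 → Bool) : List Bool :=
  [s 0 1 2, s 0 1 3, s 0 2 3, s 1 2 3, s 0 1 4, s 0 2 4, s 1 2 4, s 0 3 4, s 1 3 4, s 2 3 4,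
   s 0 1 5, s 0 2 5, s 1 2 5, s 0 3 5, s 1 3 5, s 2 3 5, s 0 4 5, s 1 4 5, s 2 4 5, s 3 4 5]

lemma lkB_LL (s : Fin 6 → Fin 6 → Fin 6 → Bool) (i j k : Fin 6) (hij : i < j) (hjk : j < k) :
    lkB (LL s) i j k = s i j k := by
  fin_cases k <;> fin_cases j <;> first | (exfalso; revert hjk; decide) | skip
  all_goals (fin_cases i <;> first | (exfalso; revert hij; decide) | rfl)

lemma sgB_LL (s : Fin 6 → Fin 6 → Fin 6 → Bool)
    (h1 : ∀ i j k : Fin 6, i ≠ j → i ≠ k → j ≠ k → s j i k = !s i j k)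
    (h2 : ∀ i j k : Fin 6, i ≠ j → i ≠ k → j ≠ k → s i k j = !s i j k)
    (i j k : Fin 6) (hij : i ≠ j) (hik : i ≠ k) (hjk : j ≠ k) :
    sgB (LL s) i j k = s i j k := by
  have hb : ∀ x y : Fin 6, Nat.blt x y = decide (x < y) := by
    intro x y
    by_cases h : x < y
    · simp only [h, decide_true]; rw [Nat.blt_eq]; exact h
    · simp only [h, decide_false]
      rw [Bool.eq_false_iff]; intro h'; rw [Nat.blt_eq] at h'; exact h h'
  unfold sgB
  simp only [hb]
  rcases lt_or_gt_of_ne hij with a | a <;> rcases lt_or_gt_of_ne hik with b | b <;>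
    rcases lt_or_gt_of_ne hjk with c | c
  · simp [a, c, lkB_LL]
  · simp [a, b, c.not_gt, lkB_LL _ _ _ _ b c, h2 i j k hij hik hjk]
  · exact absurd (a.trans c) b.not_gt
  · simp [a, b.not_gt, c.not_gt, lkB_LL _ _ _ _ b a, h2 i k j hik hij hjk.symm,
      h1 i k j hik hij hjk.symm]
  · simp [a.not_gt, b, lkB_LL _ _ _ _ a b, h1 i j k hij hik hjk]
  · exact absurd (a.trans b) c.not_gt
  · simp [a.not_gt, b.not_gt, c, lkB_LL _ _ _ _ c b, h1 i j k hij hik hjk,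
      h2 j i k hij.symm hjk hik]
  · simp [a.not_gt, b.not_gt, c.not_gt, lkB_LL _ _ _ _ c a, h1 j k i hjk hij.symm hik.symm,
      h1 i j k hij hik hjk, h2 j i k hij.symm hjk hik]

lemma sB_swap12 {X Y Z : E3} (h : D3 X Y Z ≠ 0) : sB Y X Z = !sB X Y Z := by
  have e : D3 Y X Z = - D3 X Y Z := by unfold D3; ring
  unfold sB; rw [e]
  rcases lt_or_gt_of_ne h with h | h <;> simp [h, h.le]

lemma sB_swap23 {X Y Z : E3} (h : D3 X Y Z ≠ 0) : sB X Z Y = !sB X Y Z := by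
  have e : D3 X Z Y = - D3 X Y Z := by unfold D3; ring
  unfold sB; rw [e]
  rcases lt_or_gt_of_ne h with h | h <;> simp [h, h.le]

lemma not_both {p q r t : Bool} (h1 : crB p q r t = true) (h2 : crB (!p) (!t) (!r) (!q) = true) :
    False := by
  revert p q r t; decide

end

section main
open scoped Classical

lemma count_expand (C : Fin 3 → Fin 3 → Fin 3 → Fin 3 → Prop)
    (hn : ∀ a b c d, a < c → b < d → ¬ (C a b c d ∧ C a d c b))
    (h9 : (Finset.univ.filter fun p : (Fin 3 × Fin 3) × (Fin 3 × Fin 3) =>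
      p.1.1 < p.2.1 ∧ p.1.2 ≠ p.2.2 ∧ C p.1.1 p.1.2 p.2.1 p.2.2).card = 9) :
    ∀ a b c d, a < c → b < d → C a b c d ∨ C a d c b := by
  have key : ∀ a c b d, a < c → b < d →
      (if C a b c d then 1 else 0) + (if C a d c b then 1 else 0) ≤ 1 ∧
      ((if C a b c d then 1 else 0) + (if C a d c b then 1 else 0) = 1 →
        C a b c d ∨ C a d c b) := by
    intro a c b d h1 h2
    have := hn a b c d h1 h2
    by_cases x : C a b c d <;> by_cases y : C a d c b <;> simp_all
  rw [Finset.card_filter] at h9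
  simp only [Fintype.sum_prod_type, Fin.sum_univ_three] at h9
  simp [-Finset.sum_boole] at h9
  have k1 := key 0 1 0 1 (by decide) (by decide)
  have k2 := key 0 1 0 2 (by decide) (by decide)
  have k3 := key 0 1 1 2 (by decide) (by decide)
  have k4 := key 0 2 0 1 (by decide) (by decide)
  have k5 := key 0 2 0 2 (by decide) (by decide)
  have k6 := key 0 2 1 2 (by decide) (by decide)
  have k7 := key 1 2 0 1 (by decide) (by decide)
  have k8 := key 1 2 0 2 (by decide) (by decide)
  have k9 := key 1 2 1 2 (by decide) (by decide)
  clear key hn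
  have e1 := k1.2 (by omega)
  have e2 := k2.2 (by omega)
  have e3 := k3.2 (by omega)
  have e4 := k4.2 (by omega)
  have e5 := k5.2 (by omega)
  have e6 := k6.2 (by omega)
  have e7 := k7.2 (by omega)
  have e8 := k8.2 (by omega)
  have e9 := k9.2 (by omega)
  intro a b c d h1 h2
  fin_cases a <;> fin_cases c <;> first | (exfalso; revert h1; decide) | skip
  all_goals (fin_cases b <;> fin_cases d <;> first | (exfalso; revert h2; decide) | assumption)

lemma not_cross_left {X Y W : E3} (h : LinearIndependent ℝ ![X, Y, W])
    (hXY : LinearIndependent ℝ ![X, Y]) : ¬ Crosses X Y X W := by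
  intro hc
  obtain ⟨a, b, c, d, ha, hb, hc, hd, h'⟩ := crosses_elim hXY hc
  have e0 := h' 0
  have e1 := h' 1
  have e2 := h' 2
  have k : b * D3 X Y W = 0 := by
    unfold D3
    linear_combination -(X 1 * W 2 - X 2 * W 1) * e0 + (X 0 * W 2 - X 2 * W 0) * e1
        - (X 0 * W 1 - X 1 * W 0) * e2
  exact (mul_ne_zero hb.ne' (D3_ne h)) k

lemma not_cross_right {X Y Z : E3} (h : LinearIndependent ℝ ![X, Y, Z])
    (hXY : LinearIndependent ℝ ![X, Y]) : ¬ Crosses X Y Z Y := by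
  intro hc
  obtain ⟨a, b, c, d, ha, hb, hc, hd, h'⟩ := crosses_elim hXY hc
  have e0 := h' 0
  have e1 := h' 1
  have e2 := h' 2
  have k : a * D3 X Y Z = 0 := by
    unfold D3
    linear_combination (Y 1 * Z 2 - Y 2 * Z 1) * e0 - (Y 0 * Z 2 - Y 2 * Z 0) * e1
        + (Y 0 * Z 1 - Y 1 * Z 0) * e2
  exact (mul_ne_zero ha.ne' (D3_ne h)) k

lemma pair_indep (v : Fin 6 → E3) (h : GoodImm v) (i j : Fin 6) (hij : i ≠ j) :
    LinearIndependent ℝ ![v i, v j] := by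
  obtain ⟨k, hk1, hk2⟩ : ∃ k : Fin 6, i ≠ k ∧ j ≠ k := by
    revert i j; decide
  have := (h.2 i j k hij hk1 hk2).comp ![0, 1] (by decide)
  convert this using 1
  ext x; fin_cases x <;> rfl

lemma oe_ne : ∀ a b : Fin 3, oI a ≠ eI b := by decide
lemma oo_ne : ∀ a b : Fin 3, a ≠ b → oI a ≠ oI b := by decide
lemma ee_ne : ∀ a b : Fin 3, a ≠ b → eI a ≠ eI b := by decide

lemma pat_free : ∀ b c : Fin 3, b ≠ 0 → c ≠ 0 →
    patB (oI 0) (eI 0) (oI b) (eI c) = false := by decide +kernel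
lemma pat_free' : ∀ b c : Fin 3, b ≠ 1 → c ≠ 1 →
    patB (oI 1) (eI 1) (oI b) (eI c) = false := by decide +kernel

end main

noncomputable section

/-- A geodesic immersion of `K₃,₃` with exactly 9 crossings has a unique crossing
pattern: after relabeling the vertices by a graph automorphism `ρ` of `K₃,₃`
(a permutation preserving or swapping the two parts), the crossing pairs of
disjoint edges are exactly those of `Pattern`, and the edges `12` and `34` have
no crossings at all. -/
theorem K33_nine_crossings_unique_pattern (v : Fin 6 → E3) (h : GoodImm v)
    (h9 : crossingCount v = 9) :
    ∃ ρ : Fin 6 ≃ Fin 6,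
      (∀ i j : Fin 6, ((ρ i).val % 2 = (ρ j).val % 2 ↔ i.val % 2 = j.val % 2)) ∧
      (∀ a b c d : Fin 3, a ≠ c → b ≠ d →
        (Crosses ((v ∘ ρ) (oI a)) ((v ∘ ρ) (eI b)) ((v ∘ ρ) (oI c)) ((v ∘ ρ) (eI d)) ↔
          (((oI a, eI b), (oI c, eI d)) ∈ Pattern ∨
           ((oI c, eI d), (oI a, eI b)) ∈ Pattern))) ∧
      EdgeFree (v ∘ ρ) (0, 0) ∧ EdgeFree (v ∘ ρ) (1, 1) := by
  have hD : ∀ i j k : Fin 6, i ≠ j → i ≠ k → j ≠ k → D3 (v i) (v j) (v k) ≠ 0 :=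
    fun i j k a b c => D3_ne (h.2 i j k a b c)
  set s : Fin 6 → Fin 6 → Fin 6 → Bool := fun i j k => sB (v i) (v j) (v k) with hs
  have s1 : ∀ i j k : Fin 6, i ≠ j → i ≠ k → j ≠ k → s j i k = !s i j k :=
    fun i j k a b c => sB_swap12 (hD i j k a b c)
  have s2 : ∀ i j k : Fin 6, i ≠ j → i ≠ k → j ≠ k → s i k j = !s i j k :=
    fun i j k a b c => sB_swap23 (hD i j k a b c)
  have hsg := sgB_LL s s1 s2
  have hcr : ∀ i j k l : Fin 6, i ≠ j → i ≠ k → i ≠ l → j ≠ k → j ≠ l → k ≠ l →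
      (Crosses (v i) (v j) (v k) (v l) ↔ crL (LL s) i j k l = true) := by
    intro i j k l hij hik hil hjk hjl hkl
    unfold crL
    rw [hsg j k l hjk hjl hkl, hsg i k l hik hil hkl, hsg i j l hij hil hjl, hsg i j k hij hik hjk]
    exact crosses_iff (pair_indep v h i j hij) (hD _ _ _ hjk hjl hkl) (hD _ _ _ hik hil hkl)
      (hD _ _ _ hij hil hjl) (hD _ _ _ hij hik hjk)
  have hgp : ∀ a b c d e : Fin 6, [a, b, c, d, e].Nodup →
      gpB (sgB (LL s) a b c) (sgB (LL s) a d e) (sgB (LL s) a b d) (sgB (LL s) a c e)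
        (sgB (LL s) a b e) (sgB (LL s) a c d) = true := by
    intro a b c d e hn
    simp at hn
    obtain ⟨⟨h1, h2, h3, h4⟩, ⟨h5, h6, h7⟩, ⟨h8, h9⟩, h10⟩ := hn
    rw [hsg a b c ‹_› ‹_› ‹_›, hsg a d e ‹_› ‹_› ‹_›, hsg a b d ‹_› ‹_› ‹_›, hsg a c e ‹_› ‹_› ‹_›,
      hsg a b e ‹_› ‹_› ‹_›, hsg a c d ‹_› ‹_› ‹_›]
    apply gp_sign_s14 <;> exact hD _ _ _ ‹_› ‹_› ‹_›
  have hC : ∀ a b c d : Fin 3, a ≠ c → b ≠ d →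
      (Crosses (v (oI a)) (v (eI b)) (v (oI c)) (v (eI d)) ↔
        crL (LL s) (oI a) (eI b) (oI c) (eI d) = true) := by
    intro a b c d hac hbd
    exact hcr _ _ _ _ (oe_ne _ _) (oo_ne _ _ hac) (oe_ne _ _) (oe_ne _ _).symm (ee_ne _ _ hbd)
      (oe_ne _ _)
  have hcount := count_expand
    (fun a b c d => Crosses (v (oI a)) (v (eI b)) (v (oI c)) (v (eI d))) (by
      intro a b c d hac hbd ⟨x, y⟩
      rw [hC _ _ _ _ hac.ne hbd.ne] at x
      rw [hC _ _ _ _ hac.ne hbd.ne'] at y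
      unfold crL at x y
      have n1 := oo_ne _ _ hac.ne
      have n2 := ee_ne _ _ hbd.ne
      have n3 := oe_ne a b
      have n4 := oe_ne a d
      have n5 := oe_ne c b
      have n6 := oe_ne c d
      generalize oI a = A at *
      generalize oI c = C at *
      generalize eI b = B at *
      generalize eI d = E at *
      have n5' := n5.symm
      have n6' := n6.symm
      have n2' := n2.symm
      rw [hsg _ _ _ n5' n2 n6, hsg _ _ _ n1 n4 n6, hsg _ _ _ n3 n4 n2, hsg _ _ _ n3 n1 n5'] at x
      rw [hsg _ _ _ n6' n2' n5, hsg _ _ _ n1 n3 n5, hsg _ _ _ n4 n3 n2', hsg _ _ _ n4 n1 n6'] at y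
      refine not_both x ?_
      rw [s2 E B C n2' n6' n5', s1 B E C n2 n5' n6', s2 B C E n5' n2 n6] at y
      rw [s2 A B C n3 n1 n5', s2 A B E n3 n4 n2, s2 A C E n1 n4 n6] at y
      simpa using y) h9
  have hcyc : ∀ a c b d : Fin 3, a < c ∧ b < d →
      ((crL (LL s) (oI a) (eI b) (oI c) (eI d)) || (crL (LL s) (oI a) (eI d) (oI c) (eI b))) = true := by
    intro a c b d ⟨hac, hbd⟩
    rw [Bool.or_eq_true, ← hC _ _ _ _ hac.ne hbd.ne, ← hC _ _ _ _ hac.ne hbd.ne']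
    exact hcount a b c d hac hbd
  have hfin : finB (LL s) = true :=
    k33_comb _ _ _ _ (hcyc 0 1 0 1 (by decide)) _ _ _ (hcyc 0 1 0 2 (by decide)) _ _
      (hcyc 0 1 1 2 (by decide)) (hgp 0 1 2 3 5 (by decide)) _ _ _ (hcyc 0 2 0 1 (by decide)) _ _
      (hcyc 1 2 0 1 (by decide)) (hgp 1 0 2 3 4 (by decide)) _ _ (hcyc 0 2 0 2 (by decide)) _
      (hcyc 0 2 1 2 (by decide)) _ (hcyc 1 2 0 2 (by decide)) (hcyc 1 2 1 2 (by decide)) _ _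
  obtain ⟨ρ, hpar, hρ⟩ := finB_spec hfin
  have hX : ∀ a b c d : Fin 3, a ≠ c → b ≠ d →
        (Crosses ((v ∘ ρ) (oI a)) ((v ∘ ρ) (eI b)) ((v ∘ ρ) (oI c)) ((v ∘ ρ) (eI d)) ↔
          patB (oI a) (eI b) (oI c) (eI d) = true) := by
    intro a b c d hac hbd
    rw [← hρ a b c d hac hbd]
    exact hcr _ _ _ _ (ρ.injective.ne (oe_ne _ _)) (ρ.injective.ne (oo_ne _ _ hac))
      (ρ.injective.ne (oe_ne _ _)) (ρ.injective.ne (oe_ne _ _).symm)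
      (ρ.injective.ne (ee_ne _ _ hbd)) (ρ.injective.ne (oe_ne _ _))
  have hfree : ∀ p : Fin 3 × Fin 3, (∀ b c : Fin 3, b ≠ p.1 → c ≠ p.2 →
      patB (oI p.1) (eI p.2) (oI b) (eI c) = false) → EdgeFree (v ∘ ρ) p := by
    rintro ⟨a, b⟩ hp ⟨c, d⟩ hq
    have hne : ρ (oI a) ≠ ρ (eI b) := ρ.injective.ne (oe_ne _ _)
    by_cases hac : a = c
    · subst hac
      have hbd : b ≠ d := fun e => hq (by rw [e])
      exact not_cross_left (h.2 _ _ _ hne (ρ.injective.ne (oe_ne _ _))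
        (ρ.injective.ne (ee_ne _ _ hbd))) (pair_indep v h _ _ hne)
    · by_cases hbd : b = d
      · subst hbd
        exact not_cross_right (h.2 _ _ _ hne (ρ.injective.ne (oo_ne _ _ hac))
          (ρ.injective.ne (oe_ne _ _).symm)) (pair_indep v h _ _ hne)
      · intro hc
        have h1 := (hX a b c d hac hbd).1 hc
        have h2 := hp c d (Ne.symm hac) (Ne.symm hbd)
        exact absurd (h1.symm.trans h2) (by decide)
  refine ⟨ρ, hpar, ?_, hfree (0, 0) pat_free, hfree (1, 1) pat_free'⟩
  intro a b c d hac hbd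
  rw [hX a b c d hac hbd, patB_iff]


end
end

section
/- There exist linear (straight-edge) embeddings of K_{3,3,1} in R^3 containing exactly n nontrivial 2-component links for each n ∈ {1, 2, 3, 4, 5}. -/
open scoped Classical

noncomputable section

/-! ### Integer and real polynomial data -/

/-- Determinant of three vectors. -/
def dt {R : Type} [CommRing R] (u v w : Fin 3 → R) : R :=
  u 0 * (v 1 * w 2 - v 2 * w 1) - u 1 * (v 0 * w 2 - v 2 * w 0) +
    u 2 * (v 0 * w 1 - v 1 * w 0)

/-- Cross product. -/
def cx {R : Type} [CommRing R] (u v : Fin 3 → R) : Fin 3 → R :=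
  ![u 1 * v 2 - u 2 * v 1, u 2 * v 0 - u 0 * v 2, u 0 * v 1 - u 1 * v 0]

/-- Signed (scaled) distance from the plane of the triangle `ABC`. -/
def hh {R : Type} [CommRing R] (A B C x : Fin 3 → R) : R := dt (B - A) (C - A) (x - A)

/-- Scaled barycentric coordinate of the orthogonal projection to the plane `ABC`,
the coordinate vanishing on the line `BC`. -/
def la {R : Type} [CommRing R] (A B C x : Fin 3 → R) : R :=
  dt (cx (B - A) (C - A)) (C - B) (x - B)

/-- The integer point `p` in `ℝ³`. -/
def ptZ (p : Fin 3 → ℤ) : E3 := !₂[(p 0 : ℝ), (p 1 : ℝ), (p 2 : ℝ)]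

lemma ptZ_apply (p : Fin 3 → ℤ) (i : Fin 3) : ptZ p i = (p i : ℝ) := by
  fin_cases i <;> simp [ptZ]

/-- Coordinates of a point. -/
def co (x : E3) : Fin 3 → ℝ := fun i => x i

lemma hh_cast (A B C X : Fin 3 → ℤ) :
    hh (co (ptZ A)) (co (ptZ B)) (co (ptZ C)) (co (ptZ X)) = (hh A B C X : ℤ) := by
  simp [hh, dt, co, ptZ_apply]

lemma la_cast (A B C X : Fin 3 → ℤ) :
    la (co (ptZ A)) (co (ptZ B)) (co (ptZ C)) (co (ptZ X)) = (la A B C X : ℤ) := by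
  simp [la, dt, cx, co, ptZ_apply]

/-! ### General position -/

lemma affInd_of_hh (A B C D : E3) (h : hh (co A) (co B) (co C) (co D) ≠ 0) :
    AffineIndependent ℝ ![A, B, C, D] := by
  rw [affineIndependent_iff]
  intro s w hw hs
  have key : ∀ w : Fin 4 → ℝ, ∑ i, w i = 0 → ∑ i, w i • (![A, B, C, D] : Fin 4 → E3) i = 0 →
      ∀ i, w i = 0 := by
    intro w hw hs
    simp only [Fin.sum_univ_four] at hw hs
    have e : ∀ k : Fin 3, w 0 * A k + w 1 * B k + w 2 * C k + w 3 * D k = 0 := by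
      intro k
      have := congrArg (fun x : E3 => x k) hs
      simpa using this
    have e0 := e 0
    have e1 := e 1
    have e2 := e 2
    have w0 : w 0 = - w 1 - w 2 - w 3 := by linarith
    rw [w0] at e0 e1 e2
    simp only [hh, dt, co, Pi.sub_apply] at h
    have h3 : w 3 = 0 := by
      refine (mul_eq_zero.mp ?_).resolve_right h
      linear_combination
        (((B 1 - A 1) * (C 2 - A 2) - (B 2 - A 2) * (C 1 - A 1))) * e0
        - ((B 0 - A 0) * (C 2 - A 2) - (B 2 - A 2) * (C 0 - A 0)) * e1
        + ((B 0 - A 0) * (C 1 - A 1) - (B 1 - A 1) * (C 0 - A 0)) * e2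
    have h2 : w 2 = 0 := by
      refine (mul_eq_zero.mp ?_).resolve_right h
      linear_combination
        (-((B 1 - A 1) * (D 2 - A 2) - (B 2 - A 2) * (D 1 - A 1))) * e0
        + ((B 0 - A 0) * (D 2 - A 2) - (B 2 - A 2) * (D 0 - A 0)) * e1
        - ((B 0 - A 0) * (D 1 - A 1) - (B 1 - A 1) * (D 0 - A 0)) * e2
    have h1 : w 1 = 0 := by
      refine (mul_eq_zero.mp ?_).resolve_right h
      linear_combination
        (((C 1 - A 1) * (D 2 - A 2) - (C 2 - A 2) * (D 1 - A 1))) * e0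
        - ((C 0 - A 0) * (D 2 - A 2) - (C 2 - A 2) * (D 0 - A 0)) * e1
        + ((C 0 - A 0) * (D 1 - A 1) - (C 1 - A 1) * (D 0 - A 0)) * e2
    have h0 : w 0 = 0 := by linarith
    intro i
    fin_cases i <;> assumption
  have k1 := key (fun i => if i ∈ s then w i else 0) (by simpa using hw)
    (by simpa [ite_smul] using hs)
  intro i hi
  simpa [hi] using k1 i

/-! ### Split links -/

/-- The shear along the first axis by the function `ψ` of the other two coordinates. -/
def shear (ψ : ℝ × ℝ → ℝ) (hψ : Continuous ψ) : E3 ≃ₜ E3 where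
  toFun x := !₂[x 0 - ψ (x 1, x 2), x 1, x 2]
  invFun x := !₂[x 0 + ψ (x 1, x 2), x 1, x 2]
  left_inv x := by ext i; fin_cases i <;> simp
  right_inv x := by ext i; fin_cases i <;> simp
  continuous_toFun := by
    refine (PiLp.continuous_toLp 2 _).comp (continuous_pi fun i => ?_)
    fin_cases i <;> simp <;> fun_prop
  continuous_invFun := by
    refine (PiLp.continuous_toLp 2 _).comp (continuous_pi fun i => ?_)
    fin_cases i <;> simp <;> fun_prop

/-- The rotation by the angle `θ` in the plane of the first two coordinates. -/
def rot (θ : ℝ) : E3 ≃ₜ E3 where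
  toFun x := !₂[Real.cos θ * x 0 - Real.sin θ * x 1, Real.sin θ * x 0 + Real.cos θ * x 1, x 2]
  invFun x := !₂[Real.cos θ * x 0 + Real.sin θ * x 1, - Real.sin θ * x 0 + Real.cos θ * x 1, x 2]
  left_inv x := by
    have := Real.sin_sq_add_cos_sq θ
    ext i; fin_cases i <;> simp
    · linear_combination x 0 * this
    · linear_combination x 1 * this
  right_inv x := by
    have := Real.sin_sq_add_cos_sq θ
    ext i; fin_cases i <;> simp
    · linear_combination x 0 * this
    · linear_combination x 1 * this
  continuous_toFun := by
    refine (PiLp.continuous_toLp 2 _).comp (continuous_pi fun i => ?_)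
    fin_cases i <;> simp <;> fun_prop
  continuous_invFun := by
    refine (PiLp.continuous_toLp 2 _).comp (continuous_pi fun i => ?_)
    fin_cases i <;> simp <;> fun_prop

lemma split_below (ψ : ℝ × ℝ → ℝ) (hψ : Continuous ψ) (K L : Set E3)
    (hK : ∀ x ∈ K, x 0 < ψ (x 1, x 2)) (hL : ∀ x ∈ L, ψ (x 1, x 2) < x 0) : SplitLink K L := by
  refine ⟨fun t => shear (fun q => t * ψ q) (by fun_prop), ?_, ?_, ?_, ?_, ?_⟩
  · refine (PiLp.continuous_toLp 2 _).comp (continuous_pi fun i => ?_)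
    fin_cases i <;> simp <;> fun_prop
  · refine (PiLp.continuous_toLp 2 _).comp (continuous_pi fun i => ?_)
    fin_cases i <;> simp <;> fun_prop
  · intro x
    ext i; fin_cases i <;> simp [shear]
  · intro x hx
    simpa [shear] using hK x hx
  · intro x hx
    simpa [shear] using hL x hx

lemma split_above (ψ : ℝ × ℝ → ℝ) (hψ : Continuous ψ) (K L : Set E3)
    (hK : ∀ x ∈ K, ψ (x 1, x 2) < x 0) (hL : ∀ x ∈ L, x 0 < ψ (x 1, x 2)) : SplitLink K L := by
  refine ⟨fun t => (shear (fun q => t * ψ q) (by fun_prop)).trans (rot (Real.pi * t)),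
    ?_, ?_, ?_, ?_, ?_⟩
  · refine (PiLp.continuous_toLp 2 _).comp (continuous_pi fun i => ?_)
    fin_cases i <;> simp [shear] <;> fun_prop
  · refine (PiLp.continuous_toLp 2 _).comp (continuous_pi fun i => ?_)
    fin_cases i <;> simp [rot] <;> fun_prop
  · intro x
    ext i; fin_cases i <;> simp [shear, rot]
  · intro x hx
    simpa [shear, rot] using hK x hx
  · intro x hx
    simpa [shear, rot] using hL x hx

/-- Value of an integral affine form at a real point. -/
def evR (f : Fin 4 → ℤ) (x : E3) : ℝ := f 0 * x 0 + f 1 * x 1 + f 2 * x 2 + f 3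

/-- Value of an integral affine form at an integral point. -/
def evZ (f : Fin 4 → ℤ) (p : Fin 3 → ℤ) : ℤ := f 0 * p 0 + f 1 * p 1 + f 2 * p 2 + f 3

lemma evR_pt (f : Fin 4 → ℤ) (p : Fin 3 → ℤ) : evR f (ptZ p) = (evZ f p : ℤ) := by
  simp [evR, evZ, ptZ_apply]

lemma evR_comb (f : Fin 4 → ℤ) (X Y : E3) (a b : ℝ) (h : a + b = 1) :
    evR f (a • X + b • Y) = a * evR f X + b * evR f Y := by
  simp [evR]
  linear_combination (-(f 3 : ℝ)) * h

/-- Mixed edge: `X` is in the cone, `Y` in the half-space, `(X + 3 Y) / 4` in both. -/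
def mixOK (ps : Fin 4 → Fin 4 → ℤ) (X Y : Fin 3 → ℤ) : Prop :=
  0 < evZ (ps 0) Y ∧ 0 < evZ (ps 0) X + 3 * evZ (ps 0) Y ∧
    ∀ i : Fin 3, 0 < evZ (ps i.succ) X ∧ 0 < evZ (ps i.succ) X + 3 * evZ (ps i.succ) Y

/-- The edge `XY` lies in the union of the half-space and the cone. -/
def upOK (ps : Fin 4 → Fin 4 → ℤ) (X Y : Fin 3 → ℤ) : Prop :=
  (0 < evZ (ps 0) X ∧ 0 < evZ (ps 0) Y) ∨ (mixOK ps X Y ∨ mixOK ps Y X)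

/-- The edge `XY` lies outside the union of the half-space and the cone. -/
def downOK (ps : Fin 4 → Fin 4 → ℤ) (X Y : Fin 3 → ℤ) : Prop :=
  (evZ (ps 0) X < 0 ∧ evZ (ps 0) Y < 0) ∧
    ∃ i : Fin 3, evZ (ps i.succ) X < 0 ∧ evZ (ps i.succ) Y < 0

/-- All forms have first coefficients of the same strict sign. -/
def signOK (ps : Fin 4 → Fin 4 → ℤ) : Prop :=
  (∀ i, 0 < ps i 0) ∨ (∀ i, ps i 0 < 0)

instance (ps X Y) : Decidable (mixOK ps X Y) := by unfold mixOK; infer_instance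
instance (ps X Y) : Decidable (upOK ps X Y) := by unfold upOK; infer_instance
instance (ps X Y) : Decidable (downOK ps X Y) := by unfold downOK; infer_instance
instance (ps) : Decidable (signOK ps) := by unfold signOK; infer_instance

lemma pos_comb {a b u v : ℝ} (ha : 0 ≤ a) (hb : 0 ≤ b) (hab : a + b = 1) (hu : 0 < u)
    (hv : 0 < v) : 0 < a * u + b * v := by
  rcases ha.eq_or_lt with h | h
  · subst h
    have : b = 1 := by linarith
    subst this; simpa using hv
  · have := mul_pos h hu
    have := mul_nonneg hb hv.le
    linarith

lemma mix_mem (ps : Fin 4 → Fin 4 → ℤ) (X Y : Fin 3 → ℤ) (h : mixOK ps X Y) (a b : ℝ)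
    (ha : 0 ≤ a) (hb : 0 ≤ b) (hab : a + b = 1) :
    0 < evR (ps 0) (a • ptZ X + b • ptZ Y) ∨
      ∀ i : Fin 3, 0 < evR (ps i.succ) (a • ptZ X + b • ptZ Y) := by
  obtain ⟨h1, h2, h3⟩ := h
  have h1' : (0 : ℝ) < evZ (ps 0) Y := by exact_mod_cast h1
  have h2' : (0 : ℝ) < evZ (ps 0) X + 3 * evZ (ps 0) Y := by exact_mod_cast h2
  simp only [evR_comb _ _ _ _ _ hab, evR_pt]
  rcases le_or_gt (3 * a) b with hc | hc
  · left
    have e : a * (evZ (ps 0) X : ℝ) + b * (evZ (ps 0) Y : ℝ) =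
      a * (evZ (ps 0) X + 3 * evZ (ps 0) Y) + (b - 3 * a) * evZ (ps 0) Y := by ring
    rw [e]
    rcases ha.eq_or_lt with h | h
    · subst h
      have : b = 1 := by linarith
      subst this; simpa using h1'
    · have := mul_pos h h2'
      have := mul_nonneg (sub_nonneg.2 hc) h1'.le
      linarith
  · right
    intro i
    obtain ⟨h4, h5⟩ := h3 i
    have h4' : (0 : ℝ) < evZ (ps i.succ) X := by exact_mod_cast h4
    have h5' : (0 : ℝ) < evZ (ps i.succ) X + 3 * evZ (ps i.succ) Y := by exact_mod_cast h5
    have := mul_pos (sub_pos.2 hc) h4'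
    have := mul_nonneg hb h5'.le
    linarith

lemma up_mem (ps : Fin 4 → Fin 4 → ℤ) (X Y : Fin 3 → ℤ) (h : upOK ps X Y) (x : E3)
    (hx : x ∈ segment ℝ (ptZ X) (ptZ Y)) :
    0 < evR (ps 0) x ∨ ∀ i : Fin 3, 0 < evR (ps i.succ) x := by
  obtain ⟨a, b, ha, hb, hab, rfl⟩ := hx
  rcases h with ⟨h1, h2⟩ | h | h
  · left
    rw [evR_comb _ _ _ _ _ hab, evR_pt, evR_pt]
    exact pos_comb ha hb hab (by exact_mod_cast h1) (by exact_mod_cast h2)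
  · exact mix_mem ps X Y h a b ha hb hab
  · rw [add_comm]
    exact mix_mem ps Y X h b a hb ha (by linarith)

lemma neg_mem (f : Fin 4 → ℤ) (X Y : Fin 3 → ℤ) (h1 : evZ f X < 0) (h2 : evZ f Y < 0) (x : E3)
    (hx : x ∈ segment ℝ (ptZ X) (ptZ Y)) : evR f x < 0 := by
  obtain ⟨a, b, ha, hb, hab, rfl⟩ := hx
  rw [evR_comb _ _ _ _ _ hab, evR_pt, evR_pt]
  have h1' : (0 : ℝ) < -(evZ f X : ℝ) := by
    have : (evZ f X : ℝ) < 0 := by exact_mod_cast h1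
    linarith
  have h2' : (0 : ℝ) < -(evZ f Y : ℝ) := by
    have : (evZ f Y : ℝ) < 0 := by exact_mod_cast h2
    linarith
  have := pos_comb ha hb hab h1' h2'
  linarith

lemma down_mem (ps : Fin 4 → Fin 4 → ℤ) (X Y : Fin 3 → ℤ) (h : downOK ps X Y) (x : E3)
    (hx : x ∈ segment ℝ (ptZ X) (ptZ Y)) :
    evR (ps 0) x < 0 ∧ ∃ i : Fin 3, evR (ps i.succ) x < 0 := by
  obtain ⟨⟨h1, h2⟩, i, h3, h4⟩ := h
  exact ⟨neg_mem _ _ _ h1 h2 x hx, i, neg_mem _ _ _ h3 h4 x hx⟩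

/-- The plane `f = 0` as a graph over the last two coordinates. -/
def gr (f : Fin 4 → ℤ) (q : ℝ × ℝ) : ℝ := -(f 1 * q.1 + f 2 * q.2 + f 3) / f 0

lemma gr_cont (f : Fin 4 → ℤ) : Continuous (gr f) := by
  unfold gr; fun_prop

lemma evR_gr (f : Fin 4 → ℤ) (h : f 0 ≠ 0) (x : E3) :
    evR f x = f 0 * (x 0 - gr f (x 1, x 2)) := by
  have : (f 0 : ℝ) ≠ 0 := by exact_mod_cast h
  simp only [evR, gr]
  field_simp
  ring

lemma split_of_regions (ps : Fin 4 → Fin 4 → ℤ) (hs : signOK ps) (K L : Set E3)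
    (hK : ∀ x ∈ K, evR (ps 0) x < 0 ∧ ∃ i : Fin 3, evR (ps i.succ) x < 0)
    (hL : ∀ x ∈ L, 0 < evR (ps 0) x ∨ ∀ i : Fin 3, 0 < evR (ps i.succ) x) :
    SplitLink K L := by
  have c := fun i => gr_cont (ps i)
  have c0 := c 0
  have c1 := c 1
  have c2 := c 2
  have c3 := c 3
  rcases hs with hs | hs
  · have hp : ∀ i x, 0 < evR (ps i) x ↔ gr (ps i) (x 1, x 2) < x 0 := by
      intro i x
      have : (0 : ℝ) < ps i 0 := by exact_mod_cast hs i
      rw [evR_gr _ (hs i).ne', mul_pos_iff_of_pos_left this, sub_pos]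
    have hn : ∀ i x, evR (ps i) x < 0 ↔ x 0 < gr (ps i) (x 1, x 2) := by
      intro i x
      have : (0 : ℝ) < ps i 0 := by exact_mod_cast hs i
      rw [evR_gr _ (hs i).ne', mul_neg_iff, sub_pos, sub_neg]
      constructor
      · rintro (h | h)
        · exact h.2
        · linarith [h.1]
      · intro h; exact Or.inl ⟨this, h⟩
    simp only [hp, hn, Fin.forall_fin_succ, Fin.exists_fin_succ] at hK hL
    refine split_below (fun q => min (gr (ps 0) q) (max (gr (ps 1) q) (max (gr (ps 2) q)
      (gr (ps 3) q)))) (by fun_prop) K L ?_ ?_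
    · intro x hx
      have := hK x hx
      simpa using this
    · intro x hx
      have := hL x hx
      simpa using this
  · have hp : ∀ i x, 0 < evR (ps i) x ↔ x 0 < gr (ps i) (x 1, x 2) := by
      intro i x
      have : (ps i 0 : ℝ) < 0 := by exact_mod_cast hs i
      rw [evR_gr _ (hs i).ne, mul_pos_iff, sub_pos, sub_neg]
      constructor
      · rintro (h | h)
        · linarith [h.1]
        · exact h.2
      · intro h; exact Or.inr ⟨this, h⟩
    have hn : ∀ i x, evR (ps i) x < 0 ↔ gr (ps i) (x 1, x 2) < x 0 := by
      intro i x
      have : (ps i 0 : ℝ) < 0 := by exact_mod_cast hs i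
      rw [evR_gr _ (hs i).ne, mul_neg_iff, sub_pos, sub_neg]
      constructor
      · rintro (h | h)
        · linarith [h.1]
        · exact h.2
      · intro h; exact Or.inr ⟨this, h⟩
    simp only [hp, hn, Fin.forall_fin_succ, Fin.exists_fin_succ] at hK hL
    refine split_above (fun q => max (gr (ps 0) q) (min (gr (ps 1) q) (min (gr (ps 2) q)
      (gr (ps 3) q)))) (by fun_prop) K L ?_ ?_
    · intro x hx
      have := hK x hx
      simpa using this
    · intro x hx
      have := hL x hx
      simpa using this

/-- Full split certificate. -/
def splitOK (ps : Fin 4 → Fin 4 → ℤ) (A B C D E F G : Fin 3 → ℤ) : Prop :=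
  signOK ps ∧ (downOK ps A B ∧ downOK ps B C ∧ downOK ps C A) ∧
    (upOK ps D E ∧ upOK ps E F ∧ upOK ps F G ∧ upOK ps G D)

instance (ps A B C D E F G) : Decidable (splitOK ps A B C D E F G) := by
  unfold splitOK; infer_instance

lemma split_of_cert (ps : Fin 4 → Fin 4 → ℤ) (A B C D E F G : Fin 3 → ℤ)
    (h : splitOK ps A B C D E F G) :
    SplitLink (cycle3 (ptZ A) (ptZ B) (ptZ C)) (cycle4 (ptZ D) (ptZ E) (ptZ F) (ptZ G)) := by
  obtain ⟨hs, ⟨h1, h2, h3⟩, h4, h5, h6, h7⟩ := h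
  refine split_of_regions ps hs _ _ ?_ ?_
  · rintro x ((hx | hx) | hx)
    · exact down_mem ps _ _ h1 x hx
    · exact down_mem ps _ _ h2 x hx
    · exact down_mem ps _ _ h3 x hx
  · rintro x (((hx | hx) | hx) | hx)
    · exact up_mem ps _ _ h4 x hx
    · exact up_mem ps _ _ h5 x hx
    · exact up_mem ps _ _ h6 x hx
    · exact up_mem ps _ _ h7 x hx

/-! ### Nonsplit links: one-dimensional winding estimates -/

lemma no_cross {g : ℝ → ℝ} {a b c : ℝ} (hg : ContinuousOn g (Set.uIcc a b))
    (h : ∀ t ∈ Set.uIcc a b, g t ≠ c) : g a < c ↔ g b < c := by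
  have iv := intermediate_value_uIcc hg
  by_contra hne
  have : c ∈ Set.uIcc (g a) (g b) := by
    rw [Set.mem_uIcc]
    by_cases h1 : g a < c
    · left; exact ⟨h1.le, by by_contra h2; exact hne ⟨fun _ => by linarith, fun _ => h1⟩⟩
    · right
      refine ⟨?_, by linarith⟩
      by_contra h2
      exact hne ⟨fun h3 => absurd h3 h1, fun h3 => by linarith⟩
  obtain ⟨t, ht, e⟩ := iv this
  exact h t ht e

lemma sin_floor (x : ℝ) (n : ℤ) (h0 : n * Real.pi ≤ x) (h1 : x < (n + 1) * Real.pi) :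
    (0 < Real.sin x → Even n) ∧ (Real.sin x < 0 → Odd n) := by
  have hy : 0 ≤ Real.sin (x - n * Real.pi) :=
    Real.sin_nonneg_of_nonneg_of_le_pi (by linarith) (by linarith)
  have e : Real.sin x = (-1) ^ n * Real.sin (x - n * Real.pi) := by
    have := Real.sin_add_int_mul_pi (x - n * Real.pi) n
    rw [← this]; congr 1; ring
  constructor
  · intro h
    by_contra hn
    rw [Int.not_even_iff_odd] at hn
    rw [e, hn.neg_one_zpow] at h
    linarith
  · intro h
    by_contra hn
    rw [Int.not_odd_iff_even] at hn
    rw [e, hn.neg_one_zpow] at h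
    linarith

/-- The index of the half-plane containing the angle `x`. -/
def fl (x : ℝ) : ℤ := ⌊x / Real.pi⌋

lemma fl_le (x : ℝ) : fl x * Real.pi ≤ x := by
  have := Int.floor_le (x / Real.pi)
  rwa [le_div_iff₀ Real.pi_pos] at this

lemma lt_fl (x : ℝ) : x < (fl x + 1) * Real.pi := by
  have := Int.lt_floor_add_one (x / Real.pi)
  rwa [div_lt_iff₀ Real.pi_pos] at this

lemma fl_even {x : ℝ} (h : 0 < Real.sin x) : Even (fl x) :=
  (sin_floor x _ (fl_le x) (lt_fl x)).1 h

lemma fl_odd {x : ℝ} (h : Real.sin x < 0) : Odd (fl x) :=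
  (sin_floor x _ (fl_le x) (lt_fl x)).2 h

lemma fl_eq_of_same {g : ℝ → ℝ} (hg : ContinuousOn g (Set.Icc 0 1))
    (h : ∀ t ∈ Set.Icc (0 : ℝ) 1, Real.sin (g t) ≠ 0) : fl (g 0) = fl (g 1) := by
  have key : ∀ n : ℤ, g 0 < n * Real.pi ↔ g 1 < n * Real.pi := by
    intro n
    refine no_cross (by rwa [Set.uIcc_of_le zero_le_one]) ?_
    rw [Set.uIcc_of_le zero_le_one]
    intro t ht e
    exact h t ht (by rw [e]; exact Real.sin_int_mul_pi n)
  have a0 := fl_le (g 0)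
  have a1 := lt_fl (g 0)
  have b0 := fl_le (g 1)
  have b1 := lt_fl (g 1)
  have k1 := key (fl (g 0) + 1)
  have k2 := key (fl (g 0))
  push_cast at k1 k2
  have c1 := k1.1 a1
  have c2 : fl (g 0) * Real.pi ≤ g 1 := by
    by_contra hc
    have := k2.2 (by linarith)
    linarith
  have d1 : (fl (g 0) : ℝ) < fl (g 1) + 1 := by
    have : (fl (g 0) : ℝ) * Real.pi < (fl (g 1) + 1) * Real.pi := by linarith
    exact lt_of_mul_lt_mul_right this Real.pi_pos.le
  have d2 : (fl (g 1) : ℝ) < fl (g 0) + 1 := by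
    have : (fl (g 1) : ℝ) * Real.pi < (fl (g 0) + 1) * Real.pi := by linarith
    exact lt_of_mul_lt_mul_right this Real.pi_pos.le
  norm_cast at d1 d2
  omega

lemma fl_near {g : ℝ → ℝ} {a τ : ℝ} (hg : ContinuousOn g (Set.uIcc a τ)) (n : ℤ)
    (hτ : g τ = n * Real.pi)
    (h : ∀ t ∈ Set.uIcc a τ, t ≠ τ → Real.sin (g t) ≠ 0) : fl (g a) = n ∨ fl (g a) = n - 1 := by
  have hne : ∀ k : ℤ, k ≠ n → ∀ t ∈ Set.uIcc a τ, g t ≠ k * Real.pi := by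
    intro k hk t ht e
    by_cases htt : t = τ
    · rw [htt, hτ] at e
      have := mul_right_cancel₀ Real.pi_pos.ne' e
      exact hk (by exact_mod_cast this.symm)
    · exact h t ht htt (by rw [e]; exact Real.sin_int_mul_pi k)
  have k1 := no_cross hg (hne (n + 1) (by omega))
  have k2 := no_cross hg (hne (n - 1) (by omega))
  rw [hτ] at k1 k2
  push_cast at k1 k2
  have hp := Real.pi_pos
  have c1 : g a < (n + 1) * Real.pi := k1.2 (by linarith)
  have c2 : (n - 1) * Real.pi ≤ g a := by
    by_contra hc
    have := k2.1 (by linarith)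
    linarith
  have a0 := fl_le (g a)
  have a1 := lt_fl (g a)
  have d1 : (fl (g a) : ℝ) < n + 1 := by
    have : (fl (g a) : ℝ) * Real.pi < (n + 1) * Real.pi := by linarith
    exact lt_of_mul_lt_mul_right this Real.pi_pos.le
  have d2 : (n - 1 : ℝ) < fl (g a) + 1 := by
    have : (n - 1 : ℝ) * Real.pi < (fl (g a) + 1) * Real.pi := by linarith
    exact lt_of_mul_lt_mul_right this Real.pi_pos.le
  have d3 : fl (g a) < n + 1 := by exact_mod_cast d1
  have d4 : n - 1 < fl (g a) + 1 := by exact_mod_cast d2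
  omega

/-- Transversal crossing at the time `τ`. -/
lemma cross_step {g : ℝ → ℝ} (hg : ContinuousOn g (Set.Icc 0 1)) {τ : ℝ} (h0 : 0 < τ) (h1 : τ < 1)
    (hz : Real.sin (g τ) = 0) (hnz : ∀ t ∈ Set.Icc (0 : ℝ) 1, t ≠ τ → Real.sin (g t) ≠ 0) :
    ∃ n : ℤ, g τ = n * Real.pi ∧ (fl (g 0) = n ∨ fl (g 0) = n - 1) ∧
      (fl (g 1) = n ∨ fl (g 1) = n - 1) := by
  obtain ⟨n, hn⟩ := Real.sin_eq_zero_iff.1 hz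
  have s0 : Set.uIcc 0 τ ⊆ Set.Icc (0 : ℝ) 1 := by
    rw [Set.uIcc_of_le h0.le]; exact Set.Icc_subset_Icc_right h1.le
  have s1 : Set.uIcc 1 τ ⊆ Set.Icc (0 : ℝ) 1 := by
    rw [Set.uIcc_of_ge h1.le]; exact Set.Icc_subset_Icc_left h0.le
  exact ⟨n, hn.symm, fl_near (hg.mono s0) n hn.symm fun t ht => hnz t (s0 ht),
    fl_near (hg.mono s1) n hn.symm fun t ht => hnz t (s1 ht)⟩

lemma cos_even {n : ℤ} (h : 0 < Real.cos (n * Real.pi)) : Even n := by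
  by_contra hn
  rw [Int.not_even_iff_odd] at hn
  rw [Real.cos_int_mul_pi, hn.neg_one_zpow] at h
  linarith

lemma cos_odd {n : ℤ} (h : Real.cos (n * Real.pi) < 0) : Odd n := by
  by_contra hn
  rw [Int.not_odd_iff_even] at hn
  rw [Real.cos_int_mul_pi, hn.neg_one_zpow] at h
  linarith

/-- Index jump along an edge from the values of `h` at the ends and the inside flag. -/
def jump (u v : ℤ) (ins : Prop) [Decidable ins] : ℤ :=
  if 0 < u ∧ v < 0 then (if ins then 1 else -1) else
    if u < 0 ∧ 0 < v then (if ins then -1 else 1) else 0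

/-- Index jump along an edge, in terms of an angle function `g` with `h = ρ sin g`, `m = ρ cos g`. -/
lemma edge_step {g ρ m : ℝ → ℝ} (hg : ContinuousOn g (Set.Icc 0 1)) (u v : ℤ) (hu : u ≠ 0)
    (hv : v ≠ 0) (hρ : ∀ t ∈ Set.Icc (0 : ℝ) 1, 0 < ρ t)
    (hs : ∀ t ∈ Set.Icc (0 : ℝ) 1, (1 - t) * u + t * v = ρ t * Real.sin (g t))
    (hc : ∀ t ∈ Set.Icc (0 : ℝ) 1, m t = ρ t * Real.cos (g t))
    (ins : Prop) [Decidable ins]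
    (hins : ∀ t ∈ Set.Icc (0 : ℝ) 1, (1 - t) * u + t * v = 0 → (ins → m t < 0) ∧ (¬ ins → 0 ≤ m t)) :
    fl (g 1) - fl (g 0) = jump u v ins := by
  have i0 : (0 : ℝ) ∈ Set.Icc (0 : ℝ) 1 := ⟨le_rfl, zero_le_one⟩
  have i1 : (1 : ℝ) ∈ Set.Icc (0 : ℝ) 1 := ⟨zero_le_one, le_rfl⟩
  have s0 := hs 0 i0
  have s1 := hs 1 i1
  simp only [sub_zero, one_mul, zero_mul, add_zero, sub_self, zero_add] at s0 s1
  have r0 := hρ 0 i0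
  have r1 := hρ 1 i1
  have hnz : ∀ t ∈ Set.Icc (0 : ℝ) 1, (1 - t) * (u : ℝ) + t * v ≠ 0 → Real.sin (g t) ≠ 0 := by
    intro t ht h e
    rw [hs t ht, e, mul_zero] at h
    exact h rfl
  have up : 0 < u → Even (fl (g 0)) := fun h => fl_even (by
    have : (0 : ℝ) < u := by exact_mod_cast h
    rw [s0] at this; exact (mul_pos_iff_of_pos_left r0).1 this)
  have un : u < 0 → Odd (fl (g 0)) := fun h => fl_odd (by
    have : (u : ℝ) < 0 := by exact_mod_cast h
    rw [s0] at this; exact (pos_iff_neg_of_mul_neg this).1 r0)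
  have vp : 0 < v → Even (fl (g 1)) := fun h => fl_even (by
    have : (0 : ℝ) < v := by exact_mod_cast h
    rw [s1] at this; exact (mul_pos_iff_of_pos_left r1).1 this)
  have vn : v < 0 → Odd (fl (g 1)) := fun h => fl_odd (by
    have : (v : ℝ) < 0 := by exact_mod_cast h
    rw [s1] at this; exact (pos_iff_neg_of_mul_neg this).1 r1)
  have crossing : (0 < u ∧ v < 0) ∨ (u < 0 ∧ 0 < v) → ∃ n : ℤ,
      ((ins → Odd n) ∧ (¬ ins → Even n)) ∧ (fl (g 0) = n ∨ fl (g 0) = n - 1) ∧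
      (fl (g 1) = n ∨ fl (g 1) = n - 1) := by
    intro h
    have hd : (u : ℝ) - v ≠ 0 := by
      have : u - v ≠ 0 := by omega
      exact_mod_cast this
    have hτ : 0 < (u : ℝ) / (u - v) ∧ (u : ℝ) / (u - v) < 1 := by
      rcases h with ⟨h1, h2⟩ | ⟨h1, h2⟩
      · have h1' : (0 : ℝ) < u := by exact_mod_cast h1
        have h2' : (v : ℝ) < 0 := by exact_mod_cast h2
        have : (0 : ℝ) < u - v := by linarith
        exact ⟨div_pos h1' this, by rw [div_lt_one this]; linarith⟩
      · have h1' : (u : ℝ) < 0 := by exact_mod_cast h1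
        have h2' : (0 : ℝ) < v := by exact_mod_cast h2
        have : (u : ℝ) - v < 0 := by linarith
        exact ⟨div_pos_of_neg_of_neg h1' this, by rw [div_lt_one_of_neg this]; linarith⟩
    obtain ⟨τ, hτd⟩ : ∃ τ : ℝ, τ = (u : ℝ) / (u - v) := ⟨_, rfl⟩
    rw [← hτd] at hτ
    have hτI : τ ∈ Set.Icc (0 : ℝ) 1 := ⟨hτ.1.le, hτ.2.le⟩
    have hτe : τ * (u - v) = u := by rw [hτd]; field_simp
    have hzero : ∀ t : ℝ, (1 - t) * u + t * v = (τ - t) * (u - v) := by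
      intro t; linear_combination -hτe
    have hz0 : (1 - τ) * (u : ℝ) + τ * v = 0 := by rw [hzero]; ring
    have hsin : Real.sin (g τ) = 0 := by
      have := hs τ hτI
      rw [hz0] at this
      exact (mul_eq_zero.1 this.symm).resolve_left (hρ τ hτI).ne'
    obtain ⟨n, hn, ha, hb⟩ := cross_step hg hτ.1 hτ.2 hsin (by
      intro t ht htt
      refine hnz t ht ?_
      rw [hzero]
      exact mul_ne_zero (sub_ne_zero.2 (Ne.symm htt)) hd)
    refine ⟨n, ?_, ha, hb⟩
    have hm := hc τ hτI
    have hi := hins τ hτI hz0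
    have hcos : Real.cos (g τ) ≠ 0 := by
      intro h
      have := Real.sin_sq_add_cos_sq (g τ)
      rw [h, hsin] at this
      norm_num at this
    constructor
    · intro h
      refine cos_odd ?_
      rw [← hn]
      have := hi.1 h
      rw [hm] at this
      exact (pos_iff_neg_of_mul_neg this).1 (hρ τ hτI)
    · intro h
      refine cos_even ?_
      rw [← hn]
      have := hi.2 h
      rw [hm] at this
      exact lt_of_le_of_ne ((mul_nonneg_iff_of_pos_left (hρ τ hτI)).1 this) (Ne.symm hcos)
  unfold jump
  by_cases c1 : 0 < u ∧ v < 0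
  · rw [if_pos c1]
    obtain ⟨n, ⟨p1, p2⟩, q1, q2⟩ := crossing (Or.inl c1)
    obtain ⟨a, ha⟩ := up c1.1
    obtain ⟨b, hb⟩ := vn c1.2
    by_cases hi : ins
    · obtain ⟨c, hc⟩ := p1 hi
      rw [if_pos hi]; omega
    · obtain ⟨c, hc⟩ := p2 hi
      rw [if_neg hi]; omega
  · rw [if_neg c1]
    by_cases c2 : u < 0 ∧ 0 < v
    · rw [if_pos c2]
      obtain ⟨n, ⟨p1, p2⟩, q1, q2⟩ := crossing (Or.inr c2)
      obtain ⟨a, ha⟩ := un c2.1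
      obtain ⟨b, hb⟩ := vp c2.2
      by_cases hi : ins
      · obtain ⟨c, hc⟩ := p1 hi
        rw [if_pos hi]; omega
      · obtain ⟨c, hc⟩ := p2 hi
        rw [if_neg hi]; omega
    · rw [if_neg c2]
      have := fl_eq_of_same hg (by
        intro t ht
        refine hnz t ht ?_
        rcases lt_or_gt_of_ne hu with h | h
        · have hv' : v < 0 := (lt_or_gt_of_ne hv).resolve_right fun h' => c2 ⟨h, h'⟩
          have h1 : (0 : ℝ) < -(u : ℝ) := by
            have : (u : ℝ) < 0 := by exact_mod_cast h
            linarith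
          have h2 : (0 : ℝ) < -(v : ℝ) := by
            have : (v : ℝ) < 0 := by exact_mod_cast hv'
            linarith
          have := pos_comb (sub_nonneg.2 ht.2) ht.1 (by ring) h1 h2
          intro h; linarith
        · have hv' : 0 < v := (lt_or_gt_of_ne hv).resolve_left fun h' => c1 ⟨h, h'⟩
          exact (pos_comb (sub_nonneg.2 ht.2) ht.1 (by ring) (by exact_mod_cast h)
            (by exact_mod_cast hv')).ne')
      omega

/-! ### Nonsplit links: geometry -/

lemma hh_comb (A B C X Y : Fin 3 → ℝ) (t : ℝ) :
    hh A B C ((1 - t) • X + t • Y) = (1 - t) * hh A B C X + t * hh A B C Y := by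
  simp [hh, dt]; ring

lemma la_comb (A B C X Y : Fin 3 → ℝ) (t : ℝ) :
    la A B C ((1 - t) • X + t • Y) = (1 - t) * la A B C X + t * la A B C Y := by
  simp [la, dt]; ring

lemma co_comb (X Y : E3) (a b : ℝ) : co (a • X + b • Y) = a • co X + b • co Y := by
  ext i; simp [co]

lemma hh_cont (A B C : Fin 3 → ℝ) : Continuous fun x : E3 => hh A B C (co x) := by
  simp only [hh, dt, co, Pi.sub_apply]; fun_prop

lemma la_cont (A B C : Fin 3 → ℝ) : Continuous fun x : E3 => la A B C (co x) := by
  simp only [la, dt, co, Pi.sub_apply]; fun_prop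

/-- Squared norm of the normal vector. -/
def nsq (A B C : Fin 3 → ℝ) : ℝ :=
  cx (B - A) (C - A) 0 ^ 2 + cx (B - A) (C - A) 1 ^ 2 + cx (B - A) (C - A) 2 ^ 2

lemma la_sum (A B C x : Fin 3 → ℝ) : la A B C x + la B C A x + la C A B x = nsq A B C := by
  simp [la, dt, cx, nsq]; ring

lemma bary (A B C x : Fin 3 → ℝ) (h : hh A B C x = 0) (i : Fin 3) :
    nsq A B C * x i = la A B C x * A i + la B C A x * B i + la C A B x * C i := by
  have : nsq A B C * x i = la A B C x * A i + la B C A x * B i + la C A B x * C i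
      + hh A B C x * cx (B - A) (C - A) i := by
    fin_cases i <;> simp [la, dt, cx, nsq, hh] <;> ring
  rw [this, h]; ring

lemma mem_seg_of (A B x : E3) (N b c : ℝ) (hN : 0 < N) (hb : 0 ≤ b) (hc : 0 ≤ c)
    (hs : b + c = N) (hx : ∀ i, N * x i = b * A i + c * B i) : x ∈ segment ℝ A B := by
  refine ⟨b / N, c / N, div_nonneg hb hN.le, div_nonneg hc hN.le, ?_, ?_⟩
  · rw [← add_div, hs, div_self hN.ne']
  · ext i
    have := hx i
    simp only [PiLp.add_apply, PiLp.smul_apply, smul_eq_mul]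
    field_simp
    linarith

/-- The negated minimum of the barycentric coordinates. -/
def mm (A B C x : Fin 3 → ℝ) : ℝ := -(min (la A B C x) (min (la B C A x) (la C A B x)))

lemma mem_cycle (A B C x : E3) (hn : 0 < nsq (co A) (co B) (co C))
    (h : hh (co A) (co B) (co C) (co x) = 0) (hm : mm (co A) (co B) (co C) (co x) = 0) :
    x ∈ cycle3 A B C := by
  have hb := bary _ _ _ _ h
  have hs := la_sum (co A) (co B) (co C) (co x)
  have hm' : min (la (co A) (co B) (co C) (co x)) (min (la (co B) (co C) (co A) (co x))
    (la (co C) (co A) (co B) (co x))) = 0 := by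
    unfold mm at hm; linarith
  generalize la (co A) (co B) (co C) (co x) = p at *
  generalize la (co B) (co C) (co A) (co x) = q at *
  generalize la (co C) (co A) (co B) (co x) = r at *
  have h1 : 0 ≤ p := hm' ▸ min_le_left _ _
  have h2 : 0 ≤ q := hm' ▸ (min_le_right _ _).trans (min_le_left _ _)
  have h3 : 0 ≤ r := hm' ▸ (min_le_right _ _).trans (min_le_right _ _)
  have h4 : p = 0 ∨ q = 0 ∨ r = 0 := by
    rcases min_choice p (min q r) with e | e
    · left; rw [← e, hm']
    · rcases min_choice q r with e' | e'
      · right; left; rw [← e', ← e, hm']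
      · right; right; rw [← e', ← e, hm']
  rcases h4 with rfl | rfl | rfl
  · left; right
    exact mem_seg_of B C x _ q r hn h2 h3 (by linarith) fun i => by
      have := hb i; simp only [co] at this ⊢; linarith
  · right
    exact mem_seg_of C A x _ r p hn h3 h1 (by linarith) fun i => by
      have := hb i; simp only [co] at this ⊢; linarith
  · left; left
    exact mem_seg_of A B x _ p q hn h1 h2 (by linarith) fun i => by
      have := hb i; simp only [co] at this ⊢; linarith

/-- The crossing point of the edge `XY` with the plane `ABC` is inside the triangle. -/
def insZ (A B C X Y : Fin 3 → ℤ) : Prop :=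
  0 < (hh A B C X - hh A B C Y) * (hh A B C X * la A B C Y - hh A B C Y * la A B C X) ∧
  0 < (hh A B C X - hh A B C Y) * (hh A B C X * la B C A Y - hh A B C Y * la B C A X) ∧
  0 < (hh A B C X - hh A B C Y) * (hh A B C X * la C A B Y - hh A B C Y * la C A B X)

instance (A B C X Y) : Decidable (insZ A B C X Y) := by unfold insZ; infer_instance

/-- Jump along the edge `XY` (twice the signed intersection number, up to a coboundary). -/
def jumpZ (A B C X Y : Fin 3 → ℤ) : ℤ := jump (hh A B C X) (hh A B C Y) (insZ A B C X Y)

/-- Winding of the quadrilateral `DEFG` around the triangle `ABC` in units of `π`. -/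
def windZ (A B C D E F G : Fin 3 → ℤ) : ℤ :=
  jumpZ A B C D E + jumpZ A B C E F + jumpZ A B C F G + jumpZ A B C G D

lemma ins_aux (u v p q t : ℝ) (huv : u - v ≠ 0) (h : (1 - t) * u + t * v = 0) :
    0 < (u - v) * (u * q - v * p) ↔ 0 < (1 - t) * p + t * q := by
  have e : (u - v) * (u * q - v * p) = (u - v) ^ 2 * ((1 - t) * p + t * q) := by
    linear_combination (u - v) * (q - p) * h
  rw [e, mul_pos_iff_of_pos_left (by positivity)]

lemma seg_step (A B C X Y : Fin 3 → ℤ) (hX : hh A B C X ≠ 0) (hY : hh A B C Y ≠ 0)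
    (U : Set E3) (f : E3 → ℂ) (hf : ContinuousOn f U)
    (he : ∀ x ∈ U, Complex.exp (f x) =
      ⟨mm (co (ptZ A)) (co (ptZ B)) (co (ptZ C)) (co x),
        hh (co (ptZ A)) (co (ptZ B)) (co (ptZ C)) (co x)⟩)
    (hU : segment ℝ (ptZ X) (ptZ Y) ⊆ U) :
    fl (f (ptZ Y)).im - fl (f (ptZ X)).im = jumpZ A B C X Y := by
  have hγ : ∀ t ∈ Set.Icc (0 : ℝ) 1, (1 - t) • ptZ X + t • ptZ Y ∈ U := fun t ht =>
    hU ⟨1 - t, t, sub_nonneg.2 ht.2, ht.1, by ring, rfl⟩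
  have hg : ContinuousOn (fun t : ℝ => (f ((1 - t) • ptZ X + t • ptZ Y)).im) (Set.Icc 0 1) := by
    refine Complex.continuous_im.comp_continuousOn ?_
    exact hf.comp (Continuous.continuousOn (by fun_prop)) hγ
  have := edge_step (g := fun t : ℝ => (f ((1 - t) • ptZ X + t • ptZ Y)).im)
    (ρ := fun t : ℝ => Real.exp (f ((1 - t) • ptZ X + t • ptZ Y)).re)
    (m := fun t : ℝ => mm (co (ptZ A)) (co (ptZ B)) (co (ptZ C))
      (co ((1 - t) • ptZ X + t • ptZ Y))) hg (hh A B C X) (hh A B C Y) hX hY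
    (fun t _ => Real.exp_pos _) ?_ ?_ (insZ A B C X Y) ?_
  · simpa [jumpZ] using this
  · intro t ht
    have := congrArg Complex.im (he _ (hγ t ht))
    rw [Complex.exp_im] at this
    simp only at this
    rw [this, co_comb, hh_comb, hh_cast, hh_cast]
  · intro t ht
    have := congrArg Complex.re (he _ (hγ t ht))
    rw [Complex.exp_re] at this
    exact this.symm
  · intro t ht h0
    have huv : ((hh A B C X : ℤ) : ℝ) - (hh A B C Y : ℤ) ≠ 0 := by
      intro h
      have hu : ((hh A B C X : ℤ) : ℝ) = 0 := by linear_combination h0 + t * h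
      exact hX (by exact_mod_cast hu)
    have key : insZ A B C X Y ↔ mm (co (ptZ A)) (co (ptZ B)) (co (ptZ C))
        (co ((1 - t) • ptZ X + t • ptZ Y)) < 0 := by
      unfold mm
      rw [neg_lt_zero, lt_min_iff, lt_min_iff]
      simp only [co_comb, la_comb, la_cast]
      rw [← ins_aux _ _ _ _ t huv h0, ← ins_aux _ _ _ _ t huv h0, ← ins_aux _ _ _ _ t huv h0]
      unfold insZ
      norm_cast
    exact ⟨key.1, fun h => not_lt.1 fun h' => h (key.2 h')⟩

lemma nonsplit_of_wind (A B C D E F G : Fin 3 → ℤ) (hD : hh A B C D ≠ 0) (hE : hh A B C E ≠ 0)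
    (hF : hh A B C F ≠ 0) (hG : hh A B C G ≠ 0) (hw : windZ A B C D E F G ≠ 0) :
    ¬ SplitLink (cycle3 (ptZ A) (ptZ B) (ptZ C)) (cycle4 (ptZ D) (ptZ E) (ptZ F) (ptZ G)) := by
  rintro ⟨H, -, -, -, hK, hL⟩
  obtain ⟨V, hV⟩ : ∃ V : Set E3, V = {x : E3 | 0 < x 0} := ⟨_, rfl⟩
  have hVo : IsOpen V := by
    rw [hV]; exact isOpen_lt continuous_const (by fun_prop)
  have hVc : Convex ℝ V := by
    rw [hV]
    intro x hx y hy a b ha hb hab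
    simp only [Set.mem_ofPred_eq, PiLp.add_apply, PiLp.smul_apply, smul_eq_mul] at *
    exact pos_comb ha hb hab hx hy
  have hVn : V.Nonempty := ⟨H 1 (ptZ D), by
    rw [hV]; exact hL _ (Or.inl (Or.inl (Or.inl (left_mem_segment ℝ _ _))))⟩
  have hUo : IsOpen (H 1 ⁻¹' V) := hVo.preimage (H 1).continuous
  have hUs : IsSimplyConnected (H 1 ⁻¹' V) := by
    rw [Homeomorph.isSimplyConnected_preimage]
    have := hVc.contractibleSpace hVn
    have : SimplyConnectedSpace V := inferInstance
    exact this
  have hn : 0 < nsq (co (ptZ A)) (co (ptZ B)) (co (ptZ C)) := by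
    by_contra hc
    have h0 : nsq (co (ptZ A)) (co (ptZ B)) (co (ptZ C)) = 0 :=
      le_antisymm (not_lt.1 hc) (by unfold nsq; positivity)
    have e : ∀ i, cx (co (ptZ B) - co (ptZ A)) (co (ptZ C) - co (ptZ A)) i = 0 := by
      unfold nsq at h0
      intro i
      have a0 := sq_nonneg (cx (co (ptZ B) - co (ptZ A)) (co (ptZ C) - co (ptZ A)) 0)
      have a1 := sq_nonneg (cx (co (ptZ B) - co (ptZ A)) (co (ptZ C) - co (ptZ A)) 1)
      have a2 := sq_nonneg (cx (co (ptZ B) - co (ptZ A)) (co (ptZ C) - co (ptZ A)) 2)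
      fin_cases i <;> exact pow_eq_zero_iff (two_ne_zero) |>.1 (by simp only [Fin.zero_eta, Fin.mk_one, Fin.reduceFinMk]; linarith)
    have e0 := e 0
    have e1 := e 1
    have e2 := e 2
    have : hh (co (ptZ A)) (co (ptZ B)) (co (ptZ C)) (co (ptZ D)) = 0 := by
      simp only [cx, Matrix.cons_val_zero, Matrix.cons_val_one, Matrix.cons_val] at e0 e1 e2
      simp only [hh, dt]
      linear_combination (co (ptZ D) - co (ptZ A)) 0 * e0 + (co (ptZ D) - co (ptZ A)) 1 * e1
        + (co (ptZ D) - co (ptZ A)) 2 * e2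
    rw [hh_cast] at this
    exact hD (by exact_mod_cast this)
  have c1 := hh_cont (co (ptZ A)) (co (ptZ B)) (co (ptZ C))
  have c2 := la_cont (co (ptZ A)) (co (ptZ B)) (co (ptZ C))
  have c3 := la_cont (co (ptZ B)) (co (ptZ C)) (co (ptZ A))
  have c4 := la_cont (co (ptZ C)) (co (ptZ A)) (co (ptZ B))
  have c5 : Continuous fun x : E3 => mm (co (ptZ A)) (co (ptZ B)) (co (ptZ C)) (co x) := by
    unfold mm; exact (c2.min (c3.min c4)).neg
  have hc : Continuous fun x : E3 => (⟨mm (co (ptZ A)) (co (ptZ B)) (co (ptZ C)) (co x),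
        hh (co (ptZ A)) (co (ptZ B)) (co (ptZ C)) (co x)⟩ : ℂ) :=
    Complex.equivRealProdCLM.symm.continuous.comp (c5.prodMk c1)
  obtain ⟨f, hf, he⟩ := Complex.exists_continuousOn_eqOn_exp_comp hUs hUo hc.continuousOn (by
    rintro ⟨x, hx, h⟩
    have h1 := congrArg Complex.re h
    have h2 := congrArg Complex.im h
    simp only [Complex.zero_re, Complex.zero_im] at h1 h2
    have := hK x (mem_cycle _ _ _ x hn h2 h1)
    have hx' : 0 < H 1 x 0 := by rw [hV] at hx; exact hx
    linarith)
  have hLU : cycle4 (ptZ D) (ptZ E) (ptZ F) (ptZ G) ⊆ H 1 ⁻¹' V := by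
    intro x hx
    rw [hV]; exact hL x hx
  have s1 := seg_step A B C D E hD hE _ f hf he
    (fun x hx => hLU (Or.inl (Or.inl (Or.inl hx))))
  have s2 := seg_step A B C E F hE hF _ f hf he
    (fun x hx => hLU (Or.inl (Or.inl (Or.inr hx))))
  have s3 := seg_step A B C F G hF hG _ f hf he (fun x hx => hLU (Or.inl (Or.inr hx)))
  have s4 := seg_step A B C G D hG hD _ f hf he (fun x hx => hLU (Or.inr hx))
  apply hw
  unfold windZ
  rw [← s1, ← s2, ← s3, ← s4]
  ring

/-! ### The five examples -/

/-- Winding of the pair of cycles indexed by `(a, b)`. -/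
def windOf (w : Fin 7 → Fin 3 → ℤ) (a b : Fin 3) : ℤ :=
  windZ (w 6) (w (odds a)) (w (evens b))
    (w (odds (a + 1))) (w (evens (b + 1))) (w (odds (a + 2))) (w (evens (b + 2)))

/-- The pair indexed by `(a, b)` is split by the certificate `ps`. -/
def splitOf (ps : Fin 4 → Fin 4 → ℤ) (w : Fin 7 → Fin 3 → ℤ) (a b : Fin 3) : Prop :=
  splitOK ps (w 6) (w (odds a)) (w (evens b))
    (w (odds (a + 1))) (w (evens (b + 1))) (w (odds (a + 2))) (w (evens (b + 2)))

instance (ps w a b) : Decidable (splitOf ps w a b) := by unfold splitOf; infer_instance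

/-- Certificate given by a single plane. -/
def pl (f : Fin 4 → ℤ) : Fin 4 → Fin 4 → ℤ := fun _ => f

lemma main_lemma (n : ℕ) (w : Fin 7 → Fin 3 → ℤ)
    (gen : ∀ i j k l : Fin 7, i ≠ j → i ≠ k → i ≠ l → j ≠ k → j ≠ l → k ≠ l →
      hh (w i) (w j) (w k) (w l) ≠ 0)
    (cert : Fin 3 → Fin 3 → Fin 4 → Fin 4 → ℤ)
    (hc : ∀ a b, windOf w a b ≠ 0 ∨ splitOf (cert a b) w a b)
    (hn : (Finset.univ.filter fun p : Fin 3 × Fin 3 => windOf w p.1 p.2 ≠ 0).card = n) :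
    ∃ v : Fin 7 → E3, GenPos7 v ∧ linkCount v = n := by
  refine ⟨fun i => ptZ (w i), ?_, ?_⟩
  · intro i j k l h1 h2 h3 h4 h5 h6
    apply affInd_of_hh
    rw [hh_cast]
    exact_mod_cast gen i j k l h1 h2 h3 h4 h5 h6
  · rw [← hn]
    unfold linkCount
    congr 1
    ext ⟨a, b⟩
    simp only [Finset.mem_filter, Finset.mem_univ, true_and]
    have d6 : ∀ c, (6 : Fin 7) ≠ odds c ∧ (6 : Fin 7) ≠ evens c := by decide
    have doe : ∀ c d, odds c ≠ evens d := by decide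
    have dsh : ∀ c, odds c ≠ odds (c + 1) ∧ odds c ≠ odds (c + 2) ∧
      evens c ≠ evens (c + 1) ∧ evens c ≠ evens (c + 2) := by decide
    constructor
    · intro h
      rcases hc a b with h' | h'
      · exact h'
      · exact absurd (split_of_cert _ _ _ _ _ _ _ _ h') h
    · intro h
      refine nonsplit_of_wind _ _ _ _ _ _ _ ?_ ?_ ?_ ?_ h
      · exact gen _ _ _ _ (d6 _).1 (d6 _).2 (d6 _).1 (doe _ _) (dsh _).1 (doe _ _).symm
      · exact gen _ _ _ _ (d6 _).1 (d6 _).2 (d6 _).2 (doe _ _) (doe _ _) (dsh _).2.2.1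
      · exact gen _ _ _ _ (d6 _).1 (d6 _).2 (d6 _).1 (doe _ _) (dsh _).2.1 (doe _ _).symm
      · exact gen _ _ _ _ (d6 _).1 (d6 _).2 (d6 _).2 (doe _ _) (doe _ _) (dsh _).2.2.2

/-- The points of the example with 1 link(s). -/
def ex1 : Fin 7 → Fin 3 → ℤ :=
  ![![-3, 3, -1], ![1, 0, 2], ![3, -1, 2], ![1, -3, -3], ![0, -2, -1], ![-1, 0, -1], ![-2, -3, 2]]

lemma exists_1 : ∃ v : Fin 7 → E3, GenPos7 v ∧ linkCount v = 1 := by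
  refine main_lemma 1 ex1 (by decide +kernel)
    ![![pl ![2, 0, -2, 1], pl ![4, 2, 2, 7], pl ![2, 0, 0, 1]],
      ![pl ![-2, 0, -2, -1], pl ![-2, 4, -2, 7], pl 0],
      ![pl ![2, 2, -2, 1], pl ![2, 2, 0, 3], pl ![8, 6, -2, 5]]] (by decide +kernel) ?_
  convert (by decide +kernel : (@Finset.filter (Fin 3 × Fin 3)
    (fun p => windOf ex1 p.1 p.2 ≠ 0) (fun _ => instDecidableNot) Finset.univ).card = 1)

/-- The points of the example with 2 link(s). -/
def ex2 : Fin 7 → Fin 3 → ℤ :=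
  ![![3, 0, 3], ![-1, -3, 4], ![2, 4, -4], ![4, -3, -1], ![0, 4, 4], ![1, 0, 3], ![3, -2, 4]]

lemma exists_2 : ∃ v : Fin 7 → E3, GenPos7 v ∧ linkCount v = 2 := by
  refine main_lemma 2 ex2 (by decide +kernel)
    ![![pl ![-1, 1, -2, 8], pl ![-2, 0, 0, 5], pl ![-8, 2, -8, 31]],
      ![pl 0, pl ![-2, 2, 2, 1], pl 0],
      ![pl ![2, 0, -6, 17], ![![-24, -8, -8, 62], ![-8, -8, -24, 100], ![-8, -16, 16, -12], ![-8, 8, 0, 32]], pl ![2, -10, -22, 61]]] (by decide +kernel) ?_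
  convert (by decide +kernel : (@Finset.filter (Fin 3 × Fin 3)
    (fun p => windOf ex2 p.1 p.2 ≠ 0) (fun _ => instDecidableNot) Finset.univ).card = 2)

/-- The points of the example with 3 link(s). -/
def ex3 : Fin 7 → Fin 3 → ℤ :=
  ![![-1, 2, 3], ![0, 3, 1], ![0, -2, -3], ![2, 0, 3], ![3, 3, 0], ![1, -1, 1], ![2, -3, -2]]

lemma exists_3 : ∃ v : Fin 7 → E3, GenPos7 v ∧ linkCount v = 3 := by
  refine main_lemma 3 ex3 (by decide +kernel)
    ![![pl 0, pl 0, pl ![10, 14, -8, 5]],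
      ![pl ![2, 0, 2, -3], pl ![-14, 8, 2, 21], pl ![2, 2, 0, -1]],
      ![pl ![-4, -2, 2, 3], pl ![-2, 0, 0, 3], pl 0]] (by decide +kernel) ?_
  convert (by decide +kernel : (@Finset.filter (Fin 3 × Fin 3)
    (fun p => windOf ex3 p.1 p.2 ≠ 0) (fun _ => instDecidableNot) Finset.univ).card = 3)

/-- The points of the example with 4 link(s). -/
def ex4 : Fin 7 → Fin 3 → ℤ :=
  ![![-3, -3, 3], ![0, -1, 3], ![3, -1, 0], ![0, 1, -2], ![0, -2, -1], ![3, 3, 3], ![-3, 0, -2]]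

lemma exists_4 : ∃ v : Fin 7 → E3, GenPos7 v ∧ linkCount v = 4 := by
  refine main_lemma 4 ex4 (by decide +kernel)
    ![![pl ![2, 0, -2, 1], pl ![2, -1, 0, 0], pl ![2, -2, -1, 2]],
      ![pl 0, pl ![-2, -2, 4, 1], pl 0],
      ![pl 0, pl ![2, 0, 2, 1], pl 0]] (by decide +kernel) ?_
  convert (by decide +kernel : (@Finset.filter (Fin 3 × Fin 3)
    (fun p => windOf ex4 p.1 p.2 ≠ 0) (fun _ => instDecidableNot) Finset.univ).card = 4)

/-- The points of the example with 5 link(s). -/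
def ex5 : Fin 7 → Fin 3 → ℤ :=
  ![![2, -2, 1], ![-2, 3, -2], ![-2, -1, -3], ![-3, 3, 1], ![3, 0, 2], ![-2, -1, -2], ![-1, -1, 2]]

lemma exists_5 : ∃ v : Fin 7 → E3, GenPos7 v ∧ linkCount v = 5 := by
  refine main_lemma 5 ex5 (by decide +kernel)
    ![![pl 0, pl ![2, 2, -4, 3], pl ![2, 4, -2, 3]],
      ![pl 0, pl 0, pl ![1, 1, 0, 1]],
      ![pl 0, pl ![2, 0, -4, 1], pl 0]] (by decide +kernel) ?_
  convert (by decide +kernel : (@Finset.filter (Fin 3 × Fin 3)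
    (fun p => windOf ex5 p.1 p.2 ≠ 0) (fun _ => instDecidableNot) Finset.univ).card = 5)

/-- For every `n ∈ {1, 2, 3, 4, 5}` there is a linear (straight-edge) embedding of
`K₃,₃,₁` in `ℝ³` (seven points in general position) containing exactly `n`
nontrivial 2-component links. -/
theorem exists_embedding_with_n_links :
    ∀ n ∈ ({1, 2, 3, 4, 5} : Set ℕ),
      ∃ v : Fin 7 → E3, GenPos7 v ∧ linkCount v = n := by
  intro n hn
  simp only [Set.mem_insert_iff, Set.mem_singleton_iff] at hn
  rcases hn with rfl | rfl | rfl | rfl | rfl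
  · exact exists_1
  · exact exists_2
  · exact exists_3
  · exact exists_4
  · exact exists_5

end
end
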